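/- Suppose the structure on ℝ is d-minimal and let p be a positive integer. Let A ⊆ ℝⁿ be a definable locally closed set, g : A → ℝ a definable continuous map, and H a finite set of definable locally bounded functions A ∖ g⁻¹(0) → ℝ. Then there exists a definable C^p function φ : ℝ → ℝ such that: φ is odd, strictly increasing, surjective, and p-flat at 0 (its derivatives of order ≤ p all vanish at 0); φ(1) = 1; and lim_{x → y} φ(g(x))·h(x) = 0 for each y ∈ g⁻¹(0) and each h ∈ H. -/

import Mathlib

open FirstOrder Set Filter Topology
open scoped Classical

noncomputable section

namespace DMinPaper

variable (L : FirstOrder.Language) [L.Structure ℝ]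

/-- A subset of `ℝ^α` is definable (with parameters from `ℝ`) in the structure `L`. -/
def IsDef {α : Type} (s : Set (α → ℝ)) : Prop :=
  (Set.univ : Set ℝ).Definable L s

/-- Definability of an `ℝ`-valued function on a subset `M ⊆ ℝ^α`, via its graph. -/
def IsDefFunOn {α : Type} (M : Set (α → ℝ)) (f : (α → ℝ) → ℝ) : Prop :=
  IsDef L {z : (α ⊕ Unit) → ℝ |
    (fun i => z (Sum.inl i)) ∈ M ∧ z (Sum.inr ()) = f (fun i => z (Sum.inl i))}

/-- Definability of a map `M → ℝ^β` on a subset `M ⊆ ℝ^α`, via its graph. -/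
def IsDefMapOn {α β : Type} (M : Set (α → ℝ)) (f : (α → ℝ) → (β → ℝ)) : Prop :=
  IsDef L {z : (α ⊕ β) → ℝ |
    (fun i => z (Sum.inl i)) ∈ M ∧ (fun j => z (Sum.inr j)) = f (fun i => z (Sum.inl i))}

/-- Definability of an `ℝ`-valued function on a subset of a product `ℝ^α × ℝ^β`. -/
def IsDefFun2On {α β : Type} (S : Set ((α → ℝ) × (β → ℝ)))
    (f : (α → ℝ) × (β → ℝ) → ℝ) : Prop :=
  IsDef L {z : ((α ⊕ β) ⊕ Unit) → ℝ |
    ((fun i => z (Sum.inl (Sum.inl i)), fun j => z (Sum.inl (Sum.inr j))) ∈ S) ∧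
    z (Sum.inr ()) = f (fun i => z (Sum.inl (Sum.inl i)), fun j => z (Sum.inl (Sum.inr j)))}

/-- Definability of a map into `ℝ^γ` on a subset of a product `ℝ^α × ℝ^β`. -/
def IsDefMap2On {α β γ : Type} (S : Set ((α → ℝ) × (β → ℝ)))
    (f : (α → ℝ) × (β → ℝ) → (γ → ℝ)) : Prop :=
  IsDef L {z : ((α ⊕ β) ⊕ γ) → ℝ |
    ((fun i => z (Sum.inl (Sum.inl i)), fun j => z (Sum.inl (Sum.inr j))) ∈ S) ∧
    (fun l => z (Sum.inr l)) = f (fun i => z (Sum.inl (Sum.inl i)), fun j => z (Sum.inl (Sum.inr j)))}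

/-- Definability of a function `ℝ → ℝ`, via its graph. -/
def IsDefFunR (f : ℝ → ℝ) : Prop :=
  IsDef L {z : Fin 2 → ℝ | z 1 = f (z 0)}

/-- The structure expands the ordered field of real numbers: the order, addition and
multiplication are definable. -/
def ExpandsOrderedField : Prop :=
  IsDef L {x : Fin 2 → ℝ | x 0 < x 1} ∧
  IsDef L {x : Fin 3 → ℝ | x 2 = x 0 + x 1} ∧
  IsDef L {x : Fin 3 → ℝ | x 2 = x 0 * x 1}

/-- A discrete subset of `ℝ`. -/
def IsDiscreteSet (D : Set ℝ) : Prop :=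
  ∀ x ∈ D, ∃ U : Set ℝ, IsOpen U ∧ U ∩ D = {x}

/-- d-minimality: the structure expands the ordered field of reals, and in every definable
family of subsets of `ℝ` each fiber is the union of an open set and `N` discrete sets, where
`N` does not depend on the parameter. -/
def DMinimal : Prop :=
  ExpandsOrderedField L ∧
  ∀ (k : ℕ) (S : Set ((Fin k ⊕ Unit) → ℝ)), IsDef L S →
    ∃ N : ℕ, ∀ a : Fin k → ℝ,
      ∃ (U : Set ℝ) (D : Fin N → Set ℝ),
        IsOpen U ∧ (∀ i, IsDiscreteSet (D i)) ∧
        {t : ℝ | Sum.elim a (fun _ => t) ∈ S} = U ∪ ⋃ i, D i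

variable {E F : Type} [NormedAddCommGroup E] [NormedSpace ℝ E]
  [NormedAddCommGroup F] [NormedSpace ℝ F]

/-- `f` is of class `C^p` on `M` (as a function on the submanifold `M`): near each point of `M`
it coincides on `M` with a `C^p` function defined on an ambient open set. -/
def CpOn (p : ℕ) (f : E → F) (M : Set E) : Prop :=
  ∀ x ∈ M, ∃ (U : Set E) (g : E → F),
    IsOpen U ∧ x ∈ U ∧ ContDiffOn ℝ p g U ∧ Set.EqOn f g (M ∩ U)

/-- The tangent vectors to `M` at `x`: velocities of differentiable curves through `x`
staying in `M`. -/
def TangentVecs (M : Set E) (x : E) : Set E :=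
  {v | ∃ γ : ℝ → E, γ 0 = x ∧ (∀ᶠ t in 𝓝 (0:ℝ), γ t ∈ M) ∧ HasDerivAt γ v 0}

/-- The differential of `f : M → N` at `x` is surjective onto the tangent space of `N`
at `f x`. -/
def SubmersionAtOn (f : E → F) (M : Set E) (N : Set F) (x : E) : Prop :=
  ∀ w ∈ TangentVecs N (f x), ∃ (γ : ℝ → E) (v : E),
    γ 0 = x ∧ (∀ᶠ t in 𝓝 (0:ℝ), γ t ∈ M) ∧ HasDerivAt γ v 0 ∧
    HasDerivAt (fun t => f (γ t)) w 0

/-- `x` is a critical point of `f : M → ℝ`: the differential of `f` at `x` vanishes on all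
tangent vectors of `M` at `x`. -/
def IsCritPtOn (f : E → ℝ) (M : Set E) (x : E) : Prop :=
  x ∈ M ∧ ∀ (γ : ℝ → E) (v : E), γ 0 = x → (∀ᶠ t in 𝓝 (0:ℝ), γ t ∈ M) →
    HasDerivAt γ v 0 → HasDerivAt (fun t => f (γ t)) 0 0

/-- `x` is a nondegenerate critical point of `f : M → ℝ` on the `d`-dimensional submanifold
`M`: in a local `C²` parametrization `ψ` of `M` at `x`, the Hessian of `f ∘ ψ` is a
nondegenerate bilinear form. -/
def IsNondegCritPtOn (f : E → ℝ) (M : Set E) (d : ℕ) (x : E) : Prop :=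
  IsCritPtOn f M x ∧
  ∃ (W : Set (Fin d → ℝ)) (ψ : (Fin d → ℝ) → E) (w0 : Fin d → ℝ),
    IsOpen W ∧ w0 ∈ W ∧ ContDiffOn ℝ 2 ψ W ∧ ψ w0 = x ∧ Set.MapsTo ψ W M ∧
    Function.Injective (fun u => fderiv ℝ ψ w0 u) ∧
    ∀ v : Fin d → ℝ, v ≠ 0 → ∃ w : Fin d → ℝ,
      iteratedFDeriv ℝ 2 (fun z => f (ψ z)) w0 ![v, w] ≠ 0

/-- `f` is a Morse function on the `d`-dimensional submanifold `M`: all critical points are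
nondegenerate and distinct critical points have distinct critical values. -/
def IsMorseOn (f : E → ℝ) (M : Set E) (d : ℕ) : Prop :=
  (∀ x, IsCritPtOn f M x → IsNondegCritPtOn f M d x) ∧
  ∀ x y, IsCritPtOn f M x → IsCritPtOn f M y → x ≠ y → f x ≠ f y

/-- `M ⊆ ℝⁿ` is a definable `C^p` submanifold of dimension `d`: `M` is definable and every
point of `M` has a definable `C^p` chart of `ℝⁿ` flattening `M` onto `ℝ^d × {0}`. -/
def IsDpSubmanifold (p : ℕ) {n : ℕ} (d : ℕ) (M : Set (Fin n → ℝ)) : Prop :=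
  IsDef L M ∧ d ≤ n ∧
  ∀ x ∈ M, ∃ (U V : Set (Fin n → ℝ)) (φ ψ : (Fin n → ℝ) → (Fin n → ℝ)),
    IsOpen U ∧ x ∈ U ∧ IsOpen V ∧ (0 : Fin n → ℝ) ∈ V ∧
    IsDef L U ∧ IsDef L V ∧ IsDefMapOn L U φ ∧ IsDefMapOn L V ψ ∧
    ContDiffOn ℝ p φ U ∧ ContDiffOn ℝ p ψ V ∧
    Set.MapsTo φ U V ∧ Set.MapsTo ψ V U ∧
    (∀ y ∈ U, ψ (φ y) = y) ∧ (∀ y ∈ V, φ (ψ y) = y) ∧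
    φ x = 0 ∧ φ '' (M ∩ U) = V ∩ {y | ∀ i : Fin n, d ≤ (i : ℕ) → y i = 0}

/-- The definable set `X ⊆ ℝⁿ` has dimension at least `d`: some projection of `X` onto `d`
of the coordinates has nonempty interior. -/
def hasDimGE {n : ℕ} (X : Set (Fin n → ℝ)) (d : ℕ) : Prop :=
  ∃ ι : Fin d → Fin n, StrictMono ι ∧ (interior ((fun x => fun i => x (ι i)) '' X)).Nonempty

/-- The dimension of `X ⊆ ℝⁿ`: the largest `d` such that some coordinate projection of `X`
onto `ℝ^d` has nonempty interior; `⊥` (i.e. `-∞`) for the empty set. -/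
noncomputable def dimDef {n : ℕ} (X : Set (Fin n → ℝ)) : WithBot ℕ :=
  if X.Nonempty then ((sSup {d : ℕ | hasDimGE X d} : ℕ) : WithBot ℕ) else ⊥

/-- The coordinate projection `ℝⁿ → ℝ^d` determined by `ι`. -/
def projc {n d : ℕ} (ι : Fin d → Fin n) (x : Fin n → ℝ) : Fin d → ℝ := fun i => x (ι i)

/-- An open box in `ℝⁿ`: a product of `n` nonempty open intervals. -/
def IsOpenBox {n : ℕ} (U : Set (Fin n → ℝ)) : Prop :=
  ∃ a b : Fin n → ℝ, (∀ i, a i < b i) ∧ U = Set.univ.pi fun i => Set.Ioo (a i) (b i)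

/-- `M` is locally, at `x`, the image of a definable `C^p` section `τ` of the coordinate
projection `projc ι`. -/
def MultiGraphPtAt (p : ℕ) {n d : ℕ} (ι : Fin d → Fin n) (M : Set (Fin n → ℝ))
    (x : Fin n → ℝ) : Prop :=
  ∃ U : Set (Fin n → ℝ), IsOpenBox U ∧ x ∈ U ∧
    ∃ τ : (Fin d → ℝ) → (Fin n → ℝ),
      IsDefMapOn L (projc ι '' U) τ ∧ ContDiffOn ℝ p τ (projc ι '' U) ∧
      M ∩ U = τ '' (projc ι '' U) ∧ ∀ z ∈ projc ι '' U, projc ι (τ z) = z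

/-- A `D^p` multi-valued graph with respect to the coordinate projection `projc ι`. -/
def IsMultiGraph (p : ℕ) {n d : ℕ} (ι : Fin d → Fin n) (M : Set (Fin n → ℝ)) : Prop :=
  IsDpSubmanifold L p d M ∧ ∀ x ∈ M, MultiGraphPtAt L p ι M x

/-- The gradient vector `(∂g/∂x₁, …, ∂g/∂x_d)` of `g : ℝ^d → ℝ` at `z`. -/
noncomputable def gradVec {d : ℕ} (g : (Fin d → ℝ) → ℝ) (z : Fin d → ℝ) : Fin d → ℝ :=
  fun i => fderiv ℝ g z (Pi.single i 1)

/-- The Hessian matrix `(∂²g/∂x_i∂x_j)` of `g : ℝ^d → ℝ` at `z`. -/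
noncomputable def hessMat {d : ℕ} (g : (Fin d → ℝ) → ℝ) (z : Fin d → ℝ) :
    Matrix (Fin d) (Fin d) ℝ :=
  Matrix.of fun i j => fderiv ℝ (fun w => fderiv ℝ g w (Pi.single j 1)) z (Pi.single i 1)

/-- The derivative of `f : M → ℝ` at `x` along the vector field `D`: the common value of
`d_x g (D x)` over all local `C¹` extensions `g` of `f` (and `0` if there is no such common
value). -/
noncomputable def vderiv (M : Set E) (D : E → E) (f : E → ℝ) (x : E) : ℝ :=
  if h : ∃ w : ℝ, ∀ (U : Set E) (g : E → ℝ), IsOpen U → x ∈ U → ContDiffOn ℝ 1 g U →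
      Set.EqOn f g (M ∩ U) → fderiv ℝ g x (D x) = w
  then h.choose else 0

/-- Iterated derivative `D_{α₁} ⋯ D_{α_m} f` of `f : M → ℝ` along a finite family of vector
fields, indexed by a list `α`. -/
noncomputable def vderivIter {k : ℕ} (M : Set E) (D : Fin k → E → E) :
    List (Fin k) → (E → ℝ) → E → ℝ
  | [], f => f
  | i :: l, f => vderiv M (D i) (vderivIter M D l f)

/-- definable predicate -/
def Dp {α : Type} (P : (α → ℝ) → Prop) : Prop := (univ : Set ℝ).Definable L {v | P v}

/-- definable function -/
def Df {α : Type} (f : (α → ℝ) → ℝ) : Prop := (univ : Set ℝ).DefinableFun L f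

section dcalc
variable {L}
variable {α : Type} {P Q : (α → ℝ) → Prop} {f g : (α → ℝ) → ℝ}

@[simp] theorem Dp_and (hP : Dp L P) (hQ : Dp L Q) : Dp L (fun v => P v ∧ Q v) := hP.inter hQ
@[simp] theorem Dp_or (hP : Dp L P) (hQ : Dp L Q) : Dp L (fun v => P v ∨ Q v) := hP.union hQ
@[simp] theorem Dp_not (hP : Dp L P) : Dp L (fun v => ¬ P v) := hP.compl
theorem Dp_congr (h : ∀ v, P v ↔ Q v) (hP : Dp L P) : Dp L Q := by
  have : P = Q := by ext v; exact h v
  rwa [← this]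
@[simp] theorem Dp_imp (hP : Dp L P) (hQ : Dp L Q) : Dp L (fun v => P v → Q v) :=
  Dp_congr (P := fun v => ¬ P v ∨ Q v) (fun v => by tauto) (by simp [hP, hQ])
@[simp] theorem Dp_iff (hP : Dp L P) (hQ : Dp L Q) : Dp L (fun v => P v ↔ Q v) :=
  Dp_congr (P := fun v => (P v → Q v) ∧ (Q v → P v)) (fun v => by tauto) (by simp [hP, hQ])
theorem Dp_exv {β : Type} [Finite β] {P : (α → ℝ) → (β → ℝ) → Prop}
    (hP : Dp L (fun w : α ⊕ β → ℝ => P (fun i => w (Sum.inl i)) (fun i => w (Sum.inr i)))) :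
    Dp L (fun v => ∃ x, P v x) := Set.Definable.exists_of_finite hP
theorem Dp_allv {β : Type} [Finite β] {P : (α → ℝ) → (β → ℝ) → Prop}
    (hP : Dp L (fun w : α ⊕ β → ℝ => P (fun i => w (Sum.inl i)) (fun i => w (Sum.inr i)))) :
    Dp L (fun v => ∀ x, P v x) := Set.Definable.forall_of_finite hP
@[simp] theorem Dp_ex {P : (α → ℝ) → ℝ → Prop}
    (hP : Dp L (fun w : α ⊕ Unit → ℝ => P (fun i => w (Sum.inl i)) (w (Sum.inr ())))) :
    Dp L (fun v => ∃ x, P v x) := by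
  refine Dp_congr (fun v => ?_) (Dp_exv (P := fun v (x : Unit → ℝ) => P v (x ())) hP)
  exact ⟨fun ⟨x, h⟩ => ⟨_, h⟩, fun ⟨x, h⟩ => ⟨fun _ => x, h⟩⟩
@[simp] theorem Dp_all {P : (α → ℝ) → ℝ → Prop}
    (hP : Dp L (fun w : α ⊕ Unit → ℝ => P (fun i => w (Sum.inl i)) (w (Sum.inr ())))) :
    Dp L (fun v => ∀ x, P v x) := by
  refine Dp_congr (fun v => ?_) (Dp_allv (P := fun v (x : Unit → ℝ) => P v (x ())) hP)
  exact ⟨fun h x => h (fun _ => x), fun h x => h _⟩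
@[simp] theorem Dp_finall {ι : Type} [Finite ι] {P : (α → ℝ) → ι → Prop}
    (hP : ∀ i, Dp L (fun v => P v i)) : Dp L (fun v => ∀ i, P v i) := by
  have := Set.definable_iInter_of_finite hP
  unfold Dp
  convert this using 1
  ext v; simp
@[simp] theorem Df_var (i : α) : Df L (fun v : α → ℝ => v i) := Set.DefinableFun.proj L
@[simp] theorem Df_const (c : ℝ) : Df L (fun _ : α → ℝ => c) :=
  L.definableFun_const _ (mem_univ _)
theorem Dp_subst {β : Type} [Finite β] {P : (β → ℝ) → Prop} (hP : Dp L P)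
    {t : (α → ℝ) → β → ℝ} (ht : ∀ i, Df L (fun v => t v i)) : Dp L (fun v => P (t v)) :=
  Set.Definable.preimage_map (F := t) ht hP
theorem Df_subst {β : Type} [Finite β] {F : (β → ℝ) → ℝ} (hF : Df L F)
    {t : (α → ℝ) → β → ℝ} (ht : ∀ i, Df L (fun v => t v i)) : Df L (fun v => F (t v)) :=
  Set.DefinableFun.comp (g := t) ht hF
@[simp] theorem Dp_eq (hf : Df L f) (hg : Df L g) : Dp L (fun v => f v = g v) :=
  Set.DefinableFun.ofPred_eq hf hg
/-- function from its graph -/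
theorem Df_graph {R : (α → ℝ) → ℝ → Prop}
    (hP : Dp L (fun w : α ⊕ Unit → ℝ => R (fun i => w (Sum.inl i)) (w (Sum.inr ()))))
    (h : ∀ v y, R v y ↔ y = f v) : Df L f := by
  have := Set.Definable.preimage_comp (fun o : α ⊕ Unit => match o with
    | .inl i => some i | .inr _ => none) hP
  unfold Df Set.DefinableFun
  convert this using 1
  ext w
  simp only [Function.tupleGraph, mem_preimage, mem_ofPred_eq]
  constructor
  · intro hw
    exact (h _ _).2 hw.symm
  · intro hw
    exact ((h _ _).1 hw).symm
theorem Dp_graph (hf : Df L f) :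
  Dp L (fun w : α ⊕ Unit → ℝ => w (Sum.inr ()) = f (fun i => w (Sum.inl i))) := by
  unfold Df Set.DefinableFun at hf
  have := Set.Definable.preimage_comp (fun o : Option α => match o with
    | some i => Sum.inl i | none => Sum.inr ()) hf
  refine Dp_congr (fun v => ?_) this
  exact eq_comm
theorem Dp_graphL (hf : Df L f) :
  Dp L (fun w : α ⊕ Unit → ℝ => f (fun i => w (Sum.inl i)) = w (Sum.inr ())) :=
  Dp_congr (fun _ => eq_comm) (Dp_graph hf)

theorem Df_wk {β : Type} (hf : Df L f) :
    Df L (fun w : α ⊕ β → ℝ => f (fun i => w (Sum.inl i))) := by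
  have := Set.Definable.preimage_comp (β := Option (α ⊕ β)) (fun o : Option α => match o with
    | some i => some (Sum.inl i) | none => none) hf
  unfold Df Set.DefinableFun
  convert this using 1
  ext w
  exact Iff.rfl
theorem Dp_wk {β : Type} (hf : Dp L P) :
    Dp L (fun w : α ⊕ β → ℝ => P (fun i => w (Sum.inl i))) := by
  exact Set.Definable.preimage_comp (Sum.inl) hf

@[simp] theorem Dp_lt (hO : ExpandsOrderedField L) (hf : Df L f) (hg : Df L g) :
    Dp L (fun v => f v < g v) := by
  have := Dp_subst (P := fun x : Fin 2 → ℝ => x 0 < x 1) hO.1 (t := fun v => ![f v, g v])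
    (by intro i; fin_cases i <;> simpa)
  simpa using this
@[simp] theorem Dp_le (hO : ExpandsOrderedField L) (hf : Df L f) (hg : Df L g) :
    Dp L (fun v => f v ≤ g v) :=
  Dp_congr (P := fun v => ¬ g v < f v) (fun _ => not_lt) (Dp_not (Dp_lt hO hg hf))
@[simp] theorem Df_add (hO : ExpandsOrderedField L) (hf : Df L f) (hg : Df L g) :
    Df L (fun v => f v + g v) := by
  refine Df_graph (R := fun v y => y = f v + g v) ?_ (fun _ _ => Iff.rfl)
  have := Dp_subst (P := fun x : Fin 3 → ℝ => x 2 = x 0 + x 1) hO.2.1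
    (t := fun w : α ⊕ Unit → ℝ => ![f (fun i => w (Sum.inl i)), g (fun i => w (Sum.inl i)), w (Sum.inr ())])
    (by intro i; fin_cases i; exacts [Df_wk hf, Df_wk hg, Df_var _])
  simpa using this
@[simp] theorem Df_mul (hO : ExpandsOrderedField L) (hf : Df L f) (hg : Df L g) :
    Df L (fun v => f v * g v) := by
  refine Df_graph (R := fun v y => y = f v * g v) ?_ (fun _ _ => Iff.rfl)
  have := Dp_subst (P := fun x : Fin 3 → ℝ => x 2 = x 0 * x 1) hO.2.2
    (t := fun w : α ⊕ Unit → ℝ => ![f (fun i => w (Sum.inl i)), g (fun i => w (Sum.inl i)), w (Sum.inr ())])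
    (by intro i; fin_cases i; exacts [Df_wk hf, Df_wk hg, Df_var _])
  simpa using this
@[simp] theorem Df_neg (hO : ExpandsOrderedField L) (hf : Df L f) :
    Df L (fun v => - f v) := by
  have := Df_mul hO (Df_const (-1)) hf
  simpa only [neg_one_mul] using this
@[simp] theorem Df_sub (hO : ExpandsOrderedField L) (hf : Df L f) (hg : Df L g) :
    Df L (fun v => f v - g v) := by
  simpa only [sub_eq_add_neg] using Df_add hO hf (Df_neg hO hg)
@[simp] theorem Df_pow (hO : ExpandsOrderedField L) (hf : Df L f) (n : ℕ) :
    Df L (fun v => f v ^ n) := by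
  induction n with
  | zero => simp only [pow_zero]; exact Df_const 1
  | succ n ih => simp only [pow_succ]; exact Df_mul hO ih hf
@[simp] theorem Df_inv (hO : ExpandsOrderedField L) (hf : Df L f) :
    Df L (fun v => (f v)⁻¹) := by
  refine Df_graph (R := fun v y => (f v = 0 ∧ y = 0) ∨ f v * y = 1) ?_ ?_
  · exact Dp_or (Dp_and (Dp_eq (Df_wk hf) (Df_const _)) (Dp_eq (Df_var _) (Df_const _)))
      (Dp_eq (Df_mul hO (Df_wk hf) (Df_var _)) (Df_const _))
  · intro v y
    by_cases h : f v = 0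
    · simp [h]
    · simp only [h, false_and, false_or]
      constructor
      · intro h'; field_simp; linarith
      · rintro rfl; field_simp
@[simp] theorem Df_div (hO : ExpandsOrderedField L) (hf : Df L f) (hg : Df L g) :
    Df L (fun v => f v / g v) := by
  simpa only [div_eq_mul_inv] using Df_mul hO hf (Df_inv hO hg)
@[simp] theorem Df_ite {hd : DecidablePred P} (hP : Dp L P) (hf : Df L f) (hg : Df L g) :
    Df L (fun v => if P v then f v else g v) :=
  Set.DefinableFun.ite hP hf hg
@[simp] theorem Df_max (hO : ExpandsOrderedField L) (hf : Df L f) (hg : Df L g) :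
    Df L (fun v => max (f v) (g v)) := by
  simp only [max_def]
  exact Df_ite (Dp_le hO hf hg) hg hf
@[simp] theorem Df_abs (hO : ExpandsOrderedField L) (hf : Df L f) :
    Df L (fun v => |f v|) := by
  simp only [abs]
  exact Df_max hO hf (Df_neg hO hf)
theorem Dp_reidx {P : (α → ℝ) → ℝ → Prop}
    (hP : Dp L (fun w : α ⊕ Unit → ℝ => P (fun i => w (Sum.inl i)) (w (Sum.inr ()))))
    {γ : Type} (e : (γ → ℝ) → α → ℝ) (s : (γ → ℝ) → ℝ) (he : ∃ r : α → γ, ∀ v, e v = v ∘ r)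
    (hs : ∃ r : γ, ∀ v, s v = v r) : Dp L (fun v => P (e v) (s v)) := by
  obtain ⟨r, hr⟩ := he
  obtain ⟨q, hq⟩ := hs
  refine Dp_congr (fun v => ?_) (Set.Definable.preimage_comp (Sum.elim r (fun _ => q)) hP)
  simp only [hr, hq]
  rfl
@[simp] theorem Df_sSup (hO : ExpandsOrderedField L) {P : (α → ℝ) → ℝ → Prop}
    (hP : Dp L (fun w : α ⊕ Unit → ℝ => P (fun i => w (Sum.inl i)) (w (Sum.inr ())))) :
    Df L (fun v => sSup {t | P v t}) := by
  refine Df_graph (R := fun v y =>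
    ((∃ t, P v t) ∧ (∀ t, P v t → t ≤ y) ∧ ∀ b, (∀ t, P v t → t ≤ b) → y ≤ b) ∨
    (¬ ((∃ t, P v t) ∧ ∃ b, ∀ t, P v t → t ≤ b) ∧ y = 0)) ?_ ?_
  · apply Dp_or
    · apply Dp_and
      · apply Dp_ex
        exact Dp_reidx hP _ _ ⟨_, fun v => rfl⟩ ⟨_, fun v => rfl⟩
      · apply Dp_and
        · apply Dp_all
          apply Dp_imp
          · exact Dp_reidx hP _ _ ⟨_, fun v => rfl⟩ ⟨_, fun v => rfl⟩
          · exact Dp_le hO (Df_var _) (Df_var _)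
        · apply Dp_all
          apply Dp_imp
          · apply Dp_all
            apply Dp_imp
            · exact Dp_reidx hP _ _ ⟨_, fun v => rfl⟩ ⟨_, fun v => rfl⟩
            · exact Dp_le hO (Df_var _) (Df_var _)
          · exact Dp_le hO (Df_var _) (Df_var _)
    · apply Dp_and
      · apply Dp_not
        apply Dp_and
        · apply Dp_ex
          exact Dp_reidx hP _ _ ⟨_, fun v => rfl⟩ ⟨_, fun v => rfl⟩
        · apply Dp_ex
          apply Dp_all
          apply Dp_imp
          · exact Dp_reidx hP _ _ ⟨_, fun v => rfl⟩ ⟨_, fun v => rfl⟩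
          · exact Dp_le hO (Df_var _) (Df_var _)
      · exact Dp_eq (Df_var _) (Df_const _)
  · intro v y
    by_cases h : (∃ t, P v t) ∧ ∃ b, ∀ t, P v t → t ≤ b
    · have hl : IsLUB {t | P v t} (sSup {t | P v t}) := isLUB_csSup h.1 h.2
      simp only [h, not_true, false_and, or_false, true_and]
      constructor
      · rintro ⟨h1, h2⟩
        exact IsLUB.unique (s := {t | P v t}) ⟨h1, h2⟩ hl
      · rintro rfl
        exact hl
    · have : sSup {t | P v t} = 0 := by
        by_cases h1 : ∃ t, P v t
        · exact Real.sSup_of_not_bddAbove (fun hb => h ⟨h1, hb⟩)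
        · push Not at h1
          have : {t | P v t} = ∅ := by ext t; simp [h1 t]
          rw [this, Real.sSup_empty]
      rw [this]
      simp only [h, not_false_eq_true, true_and, or_iff_right_iff_imp, and_imp]
      intro a b c
      exact absurd ⟨a, y, b⟩ h
@[simp] theorem Df_sInf (hO : ExpandsOrderedField L) {P : (α → ℝ) → ℝ → Prop}
    (hP : Dp L (fun w : α ⊕ Unit → ℝ => P (fun i => w (Sum.inl i)) (w (Sum.inr ())))) :
    Df L (fun v => sInf {t | P v t}) := by
  have : ∀ v, sInf {t | P v t} = - sSup {t | P v (-t)} := by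
    intro v; rw [Real.sInf_def]; rfl
  simp only [this]
  refine Df_neg hO (Df_sSup hO ?_)
  refine Dp_congr (P := fun w : α ⊕ Unit → ℝ => ∃ s, s = - w (Sum.inr ()) ∧
    P (fun i => w (Sum.inl i)) s) (fun w => by simp) ?_
  apply Dp_ex
  apply Dp_and
  · exact Dp_eq (Df_var _) (Df_neg hO (Df_var _))
  · exact Dp_reidx hP _ _ ⟨_, fun v => rfl⟩ ⟨_, fun v => rfl⟩

end dcalc

/-- definable unary function -/
def DR (F : ℝ → ℝ) : Prop := Df L (fun v : Unit → ℝ => F (v ()))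
/-- definable unary set -/
def DS (S : ℝ → Prop) : Prop := Dp L (fun v : Unit → ℝ => S (v ()))

section dcalc2
variable {L}
variable {α : Type}
theorem DR.app {F : ℝ → ℝ} (hF : DR L F) {t : (α → ℝ) → ℝ} (ht : Df L t) :
    Df L (fun v => F (t v)) :=
  Df_subst (t := fun v _ => t v) hF (fun _ => ht)
theorem DS.app {S : ℝ → Prop} (hF : DS L S) {t : (α → ℝ) → ℝ} (ht : Df L t) :
    Dp L (fun v => S (t v)) :=
  Dp_subst (t := fun v _ => t v) hF (fun _ => ht)
theorem DR.isDefFunR {F : ℝ → ℝ} (hF : DR L F) : IsDefFunR L F := by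
  have : Dp L (fun v : Fin 2 → ℝ => v 1 = F (v 0)) := by
    simp [hF.app]
  exact this

theorem hasDerivAt_iff_eps {F : ℝ → ℝ} {x l : ℝ} : HasDerivAt F l x ↔
    ∀ e, 0 < e → ∃ d, 0 < d ∧ ∀ y, |y - x| < d → |F y - F x - (y - x) * l| ≤ e * |y - x| := by
  rw [hasDerivAt_iff_isLittleO, Asymptotics.isLittleO_iff]
  refine forall_congr' fun e => ?_
  refine imp_congr_right fun he => ?_
  rw [Metric.eventually_nhds_iff]
  simp [Real.dist_eq]

theorem DR.hasDeriv (hO : ExpandsOrderedField L) {F : ℝ → ℝ} (hF : DR L F)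
    {t s : (α → ℝ) → ℝ} (ht : Df L t) (hs : Df L s) :
    Dp L (fun v => HasDerivAt F (s v) (t v)) := by
  have : Dp L (fun v : Bool → ℝ => HasDerivAt F (v true) (v false)) := by
    simp only [hasDerivAt_iff_eps]
    simp (maxDischargeDepth := 99) [hO, hF.app]
  exact Dp_subst this (t := fun v b => if b = true then s v else t v)
    (by intro b; cases b <;> simpa)

theorem DR.diff (hO : ExpandsOrderedField L) {F : ℝ → ℝ} (hF : DR L F) :
    DS L (fun x => DifferentiableAt ℝ F x) := by
  have : ∀ x, DifferentiableAt ℝ F x ↔ ∃ l, HasDerivAt F l x :=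
    fun x => ⟨fun h => ⟨_, h.hasDerivAt⟩, fun ⟨l, h⟩ => h.differentiableAt⟩
  simp only [DS, this]
  exact Dp_ex (hF.hasDeriv hO (Df_var _) (Df_var _))

theorem DR.deriv (hO : ExpandsOrderedField L) {F : ℝ → ℝ} (hF : DR L F) :
    DR L (deriv F) := by
  refine Df_graph (R := fun v y => HasDerivAt F y (v ()) ∨ (¬ (DifferentiableAt ℝ F (v ())) ∧ y = 0)) ?_ ?_
  · exact Dp_or (hF.hasDeriv hO (Df_var _) (Df_var _)) (Dp_and (Dp_not (DS.app (hF.diff hO) (Df_var _)))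
      (Dp_eq (Df_var _) (Df_const _)))
  · intro v y
    by_cases h : DifferentiableAt ℝ F (v ())
    · simp only [h, not_true, false_and, or_false]
      exact ⟨fun h' => h'.deriv.symm, fun h' => h' ▸ h.hasDerivAt⟩
    · simp only [h, not_false_eq_true, true_and]
      rw [deriv_zero_of_not_differentiableAt h]
      simp only [or_iff_right_iff_imp]
      exact fun h' => absurd h'.differentiableAt h
end dcalc2

/-- all definable germs at 0+ are trivial -/
def Triv : Prop := ∀ S : ℝ → Prop, DS L S →
  (∃ d, 0 < d ∧ ∀ t, 0 < t → t < d → S t) ∨ (∃ d, 0 < d ∧ ∀ t, 0 < t → t < d → ¬ S t)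

theorem mono_of_local {F : ℝ → ℝ} {a b : ℝ}
    (hr : ∀ x ∈ Ioo a b, ∃ d, 0 < d ∧ ∀ y, x < y → y < x + d → F x ≤ F y)
    (hl : ∀ x ∈ Ioo a b, ∃ d, 0 < d ∧ ∀ y, x - d < y → y < x → F y ≤ F x) :
    MonotoneOn F (Ioo a b) := by
  intro x hx y hy hxy
  set T := {t | t ∈ Icc x y ∧ ∀ u ∈ Icc x t, F x ≤ F u} with hT
  have hxT : x ∈ T := ⟨⟨le_rfl, hxy⟩, fun u hu => by
    rw [le_antisymm hu.2 hu.1]⟩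
  have hbdd : BddAbove T := ⟨y, fun t ht => ht.1.2⟩
  set s := sSup T with hs
  have hxs : x ≤ s := le_csSup hbdd hxT
  have hsy : s ≤ y := csSup_le ⟨x, hxT⟩ (fun t ht => ht.1.2)
  have hsI : s ∈ Ioo a b := ⟨lt_of_lt_of_le hx.1 hxs, lt_of_le_of_lt hsy hy.2⟩
  have below : ∀ u, x ≤ u → u < s → F x ≤ F u := by
    intro u hu hus
    obtain ⟨t, ht, hut⟩ := exists_lt_of_lt_csSup ⟨x, hxT⟩ hus
    exact ht.2 u ⟨hu, hut.le⟩
  have hFs : F x ≤ F s := by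
    rcases hxs.eq_or_lt with h | h
    · rw [← h]
    · obtain ⟨d, hd, h1⟩ := hl s hsI
      have h2 : max x (s - d) < s := max_lt h (by linarith)
      obtain ⟨u, hu1, hu2⟩ := exists_between h2
      exact (below u ((le_max_left _ _).trans hu1.le) hu2).trans
        (h1 u (lt_of_le_of_lt (le_max_right _ _) hu1) hu2)
  rcases hsy.eq_or_lt with h | h
  · rwa [h] at hFs
  · exfalso
    obtain ⟨d, hd, h1⟩ := hr s hsI
    have h2 : s < min y (s + d) := lt_min h (by linarith)
    obtain ⟨u, hu1, hu2⟩ := exists_between h2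
    have : u ∈ T := by
      refine ⟨⟨hxs.trans hu1.le, (hu2.trans_le (min_le_left _ _)).le⟩, fun w hw => ?_⟩
      rcases lt_trichotomy w s with h3 | h3 | h3
      · exact below w hw.1 h3
      · rwa [h3]
      · exact hFs.trans (h1 w h3 (by linarith [hw.2, hu2.trans_le (min_le_right _ _)]))
    exact absurd (le_csSup hbdd this) (not_le.2 hu1)

theorem no_locmin {F : ℝ → ℝ} {δ : ℝ} (hδ : 0 < δ)
    (h : ∀ x ∈ Ioo 0 δ, ∃ a b : ℝ, a < x ∧ x < b ∧ ∀ y ∈ Ioo 0 δ, a < y → y < b →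
      (x < y → F x ≤ F y) ∧ (y < x → F x < F y)) : False := by
  have h' : ∀ x : Ioo (0:ℝ) δ, ∃ q : ℚ × ℚ, (q.1 : ℝ) < x ∧ x < (q.2 : ℝ) ∧ ∀ y ∈ Ioo 0 δ, q.1 < y → y < q.2 →
      (x < y → F x ≤ F y) ∧ (y < x → F x < F y) := by
    intro ⟨x, hx⟩
    obtain ⟨a, b, ha, hb, h1⟩ := h x hx
    obtain ⟨q, hq1, hq2⟩ := exists_rat_btwn ha
    obtain ⟨r, hr1, hr2⟩ := exists_rat_btwn hb
    exact ⟨(q, r), hq2, hr1, fun y hy h2 h3 => h1 y hy (hq1.trans h2) (h3.trans hr2)⟩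
  choose q hq using h'
  have hinj : Function.Injective q := by
    have key : ∀ x y : Ioo (0:ℝ) δ, q x = q y → ¬ (x < y) := by
      intro x y hxy hlt
      have h1 := ((hq x).2.2 y y.2 (by rw [hxy]; exact (hq y).1) (by rw [hxy]; exact (hq y).2.1)).1 hlt
      have h2 := ((hq y).2.2 x x.2 (by rw [← hxy]; exact (hq x).1) (by rw [← hxy]; exact (hq x).2.1)).2 hlt
      linarith
    intro x y hxy
    rcases lt_trichotomy x y with h3 | h3 | h3
    · exact absurd h3 (key x y hxy)
    · exact h3
    · exact absurd h3 (key y x hxy.symm)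
  have hc : Countable (Ioo (0:ℝ) δ) := hinj.countable
  have := (Set.countable_coe_iff.1 hc).measure_zero MeasureTheory.volume
  simp at this
  linarith

section triv
variable {L}
theorem Triv.right (hT : Triv L) (hO : ExpandsOrderedField L) {S : ℝ → Prop} (hS : DS L S) (x : ℝ) :
    (∃ d, 0 < d ∧ ∀ y, x < y → y < x + d → S y) ∨ (∃ d, 0 < d ∧ ∀ y, x < y → y < x + d → ¬ S y) := by
  have h1 : DS L (fun t => S (x + t)) := DS.app hS (by simp [hO])
  rcases hT _ h1 with ⟨d, hd, h⟩ | ⟨d, hd, h⟩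
  · exact Or.inl ⟨d, hd, fun y h1 h2 => by
      have := h (y - x) (by linarith) (by linarith)
      simpa using this⟩
  · exact Or.inr ⟨d, hd, fun y h1 h2 => by
      have := h (y - x) (by linarith) (by linarith)
      simpa using this⟩
theorem Triv.left (hT : Triv L) (hO : ExpandsOrderedField L) {S : ℝ → Prop} (hS : DS L S) (x : ℝ) :
    (∃ d, 0 < d ∧ ∀ y, x - d < y → y < x → S y) ∨ (∃ d, 0 < d ∧ ∀ y, x - d < y → y < x → ¬ S y) := by
  have h1 : DS L (fun t => S (x - t)) := DS.app hS (by simp [hO])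
  rcases hT _ h1 with ⟨d, hd, h⟩ | ⟨d, hd, h⟩
  · exact Or.inl ⟨d, hd, fun y h1 h2 => by
      have := h (x - y) (by linarith) (by linarith)
      simpa using this⟩
  · exact Or.inr ⟨d, hd, fun y h1 h2 => by
      have := h (x - y) (by linarith) (by linarith)
      simpa using this⟩

theorem Triv.mono (hT : Triv L) (hO : ExpandsOrderedField L) {F : ℝ → ℝ} (hF : DR L F) :
    ∃ δ, 0 < δ ∧ (MonotoneOn F (Ioo 0 δ) ∨ AntitoneOn F (Ioo 0 δ)) := by
  have hr := hT (fun x => ∃ d, 0 < d ∧ ∀ y, x < y → y < x + d → F x ≤ F y)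
    (by simp (maxDischargeDepth := 99) [DS, hO, hF.app])
  have hl := hT (fun x => ∃ d, 0 < d ∧ ∀ y, x - d < y → y < x → F y ≤ F x)
    (by simp (maxDischargeDepth := 99) [DS, hO, hF.app])
  have hr' : ∀ x, (¬ ∃ d, 0 < d ∧ ∀ y, x < y → y < x + d → F x ≤ F y) →
      ∃ d, 0 < d ∧ ∀ y, x < y → y < x + d → F y < F x := by
    intro x hx
    rcases hT.right hO (S := fun y => F x ≤ F y) (by simp (maxDischargeDepth := 99) [DS, hO, hF.app]) x with h | h
    · exact absurd h hx
    · simpa only [not_le] using h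
  have hl' : ∀ x, (¬ ∃ d, 0 < d ∧ ∀ y, x - d < y → y < x → F y ≤ F x) →
      ∃ d, 0 < d ∧ ∀ y, x - d < y → y < x → F x < F y := by
    intro x hx
    rcases hT.left hO (S := fun y => F y ≤ F x) (by simp (maxDischargeDepth := 99) [DS, hO, hF.app]) x with h | h
    · exact absurd h hx
    · simpa only [not_le] using h
  rcases hr with ⟨d1, hd1, h1⟩ | ⟨d1, hd1, h1⟩ <;> rcases hl with ⟨d2, hd2, h2⟩ | ⟨d2, hd2, h2⟩
  all_goals
    have hm : 0 < min d1 d2 := lt_min hd1 hd2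
    have e1 : ∀ x ∈ Ioo 0 (min d1 d2), x < d1 := fun x hx => hx.2.trans_le (min_le_left _ _)
    have e2 : ∀ x ∈ Ioo 0 (min d1 d2), x < d2 := fun x hx => hx.2.trans_le (min_le_right _ _)
  · refine ⟨min d1 d2, hm, Or.inl (mono_of_local (fun x hx => ?_) (fun x hx => ?_))⟩
    · exact h1 x hx.1 (e1 x hx)
    · exact h2 x hx.1 (e2 x hx)
  · exfalso
    refine no_locmin (F := F) hm (fun x hx => ?_)
    obtain ⟨d, hd, h3⟩ := h1 x hx.1 (e1 x hx)
    obtain ⟨e, he, h4⟩ := hl' x (h2 x hx.1 (e2 x hx))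
    exact ⟨x - e, x + d, by linarith, by linarith, fun y _ hy1 hy2 =>
      ⟨fun h => h3 y h hy2, fun h => h4 y hy1 h⟩⟩
  · exfalso
    refine no_locmin (F := fun x => - F (min d1 d2 - x)) hm (fun x hx => ?_)
    have hx' : min d1 d2 - x ∈ Ioo 0 (min d1 d2) := ⟨by linarith [hx.2], by linarith [hx.1]⟩
    obtain ⟨d, hd, h3⟩ := hr' _ (h1 _ hx'.1 (e1 _ hx'))
    obtain ⟨e, he, h4⟩ := h2 _ hx'.1 (e2 _ hx')
    refine ⟨x - d, x + e, by linarith, by linarith, fun y _ hy1 hy2 =>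
      ⟨fun h => ?_, fun h => ?_⟩⟩
    · exact neg_le_neg (h4 _ (by linarith) (by linarith))
    · exact neg_lt_neg (h3 _ (by linarith) (by linarith))
  · have : MonotoneOn (fun x => - F x) (Ioo 0 (min d1 d2)) := by
      refine mono_of_local (fun x hx => ?_) (fun x hx => ?_)
      · obtain ⟨d, hd, h3⟩ := hr' x (h1 x hx.1 (e1 x hx))
        exact ⟨d, hd, fun y h h' => neg_le_neg (h3 y h h').le⟩
      · obtain ⟨d, hd, h3⟩ := hl' x (h2 x hx.1 (e2 x hx))
        exact ⟨d, hd, fun y h h' => neg_le_neg (h3 y h h').le⟩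
    exact ⟨min d1 d2, hm, Or.inr (fun x hx y hy hxy => by have := this hx hy hxy; simpa using this)⟩

theorem Triv.diff (hT : Triv L) (hO : ExpandsOrderedField L) {F : ℝ → ℝ} (hF : DR L F) :
    ∃ δ, 0 < δ ∧ ∀ x ∈ Ioo 0 δ, DifferentiableAt ℝ F x := by
  have key : ∀ {G : ℝ → ℝ} {a δ : ℝ}, 0 < a → 0 < δ → MonotoneOn G (Ioo 0 δ) → 
      (∀ t, 0 < t → t < a → ¬ DifferentiableAt ℝ G t) → False := by
    intro G a δ ha hδ hG hn
    have h1 := hG.ae_differentiableWithinAt measurableSet_Ioo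
    rw [MeasureTheory.ae_restrict_iff' measurableSet_Ioo] at h1
    have h2 : MeasureTheory.volume (Ioo 0 (min a δ)) = 0 := by
      refine MeasureTheory.measure_mono_null ?_ h1
      intro x hx hcon
      have hx2 : x ∈ Ioo 0 δ := ⟨hx.1, hx.2.trans_le (min_le_right _ _)⟩
      exact hn x hx.1 (hx.2.trans_le (min_le_left _ _))
        ((hcon hx2).differentiableAt (isOpen_Ioo.mem_nhds hx2))
    simp only [Real.volume_Ioo, sub_zero, ENNReal.ofReal_eq_zero] at h2
    linarith [lt_min ha hδ]
  rcases hT _ (hF.diff hO) with ⟨d, hd, h⟩ | ⟨d, hd, h⟩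
  · exact ⟨d, hd, fun x hx => h x hx.1 hx.2⟩
  · exfalso
    obtain ⟨δ, hδ, hm | hm⟩ := hT.mono hO hF
    · exact key hd hδ hm h
    · refine key (G := fun x => - F x) hd hδ hm.neg (fun t h1 h2 h3 => h t h1 h2 ?_)
      simpa using h3.neg
end triv

/-- conclusion of the core lemma -/
def CoreConcl (p : ℕ) (M : ℝ → ℝ) : Prop := ∃ (f : ℝ → ℝ) (δ C : ℝ), 0 < δ ∧ DR L f ∧
  ContDiffOn ℝ p f (Ioo 0 δ) ∧ StrictMonoOn f (Ioo 0 δ) ∧ (∀ x ∈ Ioo 0 δ, 0 < f x) ∧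
  (∀ j ≤ p, ∀ x ∈ Ioo 0 δ, |iteratedDeriv j f x| ≤ C * x ^ 2) ∧ ∀ x ∈ Ioo 0 δ, f x * M x ≤ x

theorem ev_iff {S : ℝ → Prop} : (∀ᶠ x in 𝓝[>] (0:ℝ), S x) ↔ ∃ d, 0 < d ∧ ∀ t, 0 < t → t < d → S t := by
  rw [Filter.Eventually, mem_nhdsGT_iff_exists_Ioo_subset]
  constructor
  · rintro ⟨d, hd, h⟩
    exact ⟨d, hd, fun t h1 h2 => h ⟨h1, h2⟩⟩
  · rintro ⟨d, hd, h⟩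
    exact ⟨d, hd, fun t ht => h t ht.1 ht.2⟩

/-- flat definable germs -/
def FF (F : ℝ → ℝ) : Prop := DR L F ∧ ∀ N : ℕ, ∀ᶠ x in 𝓝[>] (0:ℝ), |F x| ≤ x ^ N

theorem flat_deriv_aux {G : ℝ → ℝ} {δ : ℝ} (hδ : 0 < δ) (hd : ∀ x ∈ Ioo 0 δ, DifferentiableAt ℝ G x)
    (hm : MonotoneOn (deriv G) (Ioo 0 δ)) (hG : ∀ N : ℕ, ∀ᶠ x in 𝓝[>] (0:ℝ), |G x| ≤ x ^ N) (N : ℕ) :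
    ∀ᶠ x in 𝓝[>] (0:ℝ), |deriv G x| ≤ x ^ N := by
  obtain ⟨e, he, h1⟩ := ev_iff.1 (hG (N + 2))
  rw [ev_iff]
  set c : ℝ := 2 ^ (N + 2) + 4 with hc
  have hcpos : 0 < c := by positivity
  refine ⟨min (min (δ / 2) (e / 2)) (1 / c), by positivity, fun x hx hx' => ?_⟩
  have hx1 : x < δ / 2 := hx'.trans_le ((min_le_left _ _).trans (min_le_left _ _))
  have hx2 : x < e / 2 := hx'.trans_le ((min_le_left _ _).trans (min_le_right _ _))
  have hx3 : x * c < 1 := by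
    have := hx'.trans_le (min_le_right _ _)
    rwa [lt_div_iff₀ hcpos] at this
  have mvt : ∀ a b : ℝ, 0 < a → a < b → b < δ → ∃ ξ ∈ Ioo a b, deriv G ξ = (G b - G a) / (b - a) := by
    intro a b ha hab hb
    refine exists_deriv_eq_slope G hab ?_ ?_
    · intro y hy
      exact (hd y ⟨ha.trans_le hy.1, hy.2.trans_lt hb⟩).continuousAt.continuousWithinAt
    · intro y hy
      exact (hd y ⟨ha.trans hy.1, hy.2.trans hb⟩).differentiableWithinAt
  obtain ⟨ξ, hξ, e1⟩ := mvt x (2 * x) hx (by linarith) (by linarith)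
  obtain ⟨η, hη, e2⟩ := mvt (x / 2) x (by linarith) (by linarith) (by linarith)
  have u1 : deriv G x ≤ deriv G ξ := hm ⟨hx, by linarith⟩ ⟨by linarith [hξ.1], by linarith [hξ.2]⟩ hξ.1.le
  have u2 : deriv G η ≤ deriv G x := hm ⟨by linarith [hη.1], by linarith [hη.2]⟩ ⟨hx, by linarith⟩ hη.2.le
  have g1 := abs_le.1 (h1 x hx (by linarith))
  have g2 := abs_le.1 (h1 (2 * x) (by linarith) (by linarith))
  have g3 := abs_le.1 (h1 (x / 2) (by linarith) (by linarith))
  have g4 : (x / 2) ^ (N + 2) ≤ x ^ (N + 2) := pow_le_pow_left₀ (by linarith) (by linarith) _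
  have hxN : 0 < x ^ N := by positivity
  have hxx : x ^ N * (x * c) ≤ x ^ N := by nlinarith
  rw [mul_pow] at g2
  have hp : x ^ (N + 2) = x ^ N * x * x := by ring
  rw [abs_le]
  constructor
  · have : -(x ^ N) * (x - x / 2) ≤ G x - G (x / 2) := by
      have h4 : (2 : ℝ) ^ (N + 2) > 0 := by positivity
      have : 4 * (x ^ N * x * x) ≤ x ^ N * x := by
        have : x ^ N * (x * 4) ≤ x ^ N := by
          have : x ^ N * (x * 4) ≤ x ^ N * (x * c) := by
            apply mul_le_mul_of_nonneg_left _ hxN.le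
            apply mul_le_mul_of_nonneg_left _ hx.le
            linarith
          linarith
        nlinarith
      rw [hp] at g1 g4
      linarith [g1.1, g3.2]
    rw [← le_div_iff₀ (by linarith), ← e2] at this
    linarith
  · have : G (2 * x) - G x ≤ x ^ N * (2 * x - x) := by
      have : (2 ^ (N + 2) + 4) * (x ^ N * x * x) ≤ x ^ N * x := by
        have := mul_le_mul_of_nonneg_right hxx hx.le
        calc _ = x ^ N * (x * c) * x := by rw [hc]; ring
          _ ≤ _ := this
      have h0 : 0 < x ^ N * x * x := by positivity
      rw [hp] at g1 g2
      linarith [g1.1, g2.2]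
    rw [← div_le_iff₀ (by linarith), ← e1] at this
    linarith

section triv4
variable {L}
theorem FF.deriv (hT : Triv L) (hO : ExpandsOrderedField L) {F : ℝ → ℝ} (hF : FF L F) : FF L (deriv F) := by
  refine ⟨hF.1.deriv hO, fun N => ?_⟩
  obtain ⟨d1, hd1, h1⟩ := hT.diff hO hF.1
  obtain ⟨d2, hd2, h2⟩ := hT.mono hO (hF.1.deriv hO)
  have hm : 0 < min d1 d2 := lt_min hd1 hd2
  have s1 : Ioo 0 (min d1 d2) ⊆ Ioo 0 d1 := Ioo_subset_Ioo_right (min_le_left _ _)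
  have s2 : Ioo 0 (min d1 d2) ⊆ Ioo 0 d2 := Ioo_subset_Ioo_right (min_le_right _ _)
  rcases h2 with h2 | h2
  · exact flat_deriv_aux hm (fun x hx => h1 x (s1 hx)) (h2.mono s2) hF.2 N
  · have e : _root_.deriv (fun x => - F x) = fun x => - _root_.deriv F x := by
      ext x; exact deriv.fun_neg
    have := flat_deriv_aux (G := fun x => - F x) hm (fun x hx => (h1 x (s1 hx)).neg)
      (by rw [e]; exact (h2.mono s2).neg) (by simpa using hF.2) N
    rw [e] at this
    simpa using this

theorem FF.cd (hT : Triv L) (hO : ExpandsOrderedField L) (p : ℕ) : ∀ {F : ℝ → ℝ}, FF L F →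
    ∃ δ, 0 < δ ∧ ContDiffOn ℝ p F (Ioo 0 δ) ∧ ∀ j ≤ p, ∀ x ∈ Ioo 0 δ, |iteratedDeriv j F x| ≤ x ^ 2 := by
  induction p with
  | zero =>
    intro F hF
    obtain ⟨d1, hd1, h1⟩ := hT.diff hO hF.1
    obtain ⟨d2, hd2, h2⟩ := ev_iff.1 (hF.2 2)
    refine ⟨min d1 d2, lt_min hd1 hd2, ?_, ?_⟩
    · simp only [Nat.cast_zero, contDiffOn_zero]
      intro x hx
      exact (h1 x ⟨hx.1, hx.2.trans_le (min_le_left _ _)⟩).continuousAt.continuousWithinAt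
    · intro j hj x hx
      obtain rfl : j = 0 := by omega
      rw [iteratedDeriv_zero]
      exact h2 x hx.1 (hx.2.trans_le (min_le_right _ _))
  | succ p ih =>
    intro F hF
    obtain ⟨d1, hd1, h1⟩ := hT.diff hO hF.1
    obtain ⟨d2, hd2, h2⟩ := ev_iff.1 (hF.2 2)
    obtain ⟨d3, hd3, h3, h4⟩ := ih (hF.deriv hT hO)
    refine ⟨min d1 (min d2 d3), lt_min hd1 (lt_min hd2 hd3), ?_, ?_⟩
    · push_cast
      rw [contDiffOn_succ_iff_deriv_of_isOpen isOpen_Ioo]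
      refine ⟨fun x hx => (h1 x ⟨hx.1, hx.2.trans_le (min_le_left _ _)⟩).differentiableWithinAt, by simp, ?_⟩
      exact h3.mono (Ioo_subset_Ioo_right ((min_le_right _ _).trans (min_le_right _ _)))
    · intro j hj x hx
      cases j with
      | zero => 
        rw [iteratedDeriv_zero]
        exact h2 x hx.1 (hx.2.trans_le ((min_le_right _ _).trans (min_le_left _ _)))
      | succ j =>
        rw [iteratedDeriv_succ']
        exact h4 j (by omega) x ⟨hx.1, hx.2.trans_le ((min_le_right _ _).trans (min_le_right _ _))⟩

theorem core_triv (hT : Triv L) (hO : ExpandsOrderedField L) (p : ℕ) {M : ℝ → ℝ} (hM : DR L M)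
    (hM0 : ∀ x, 0 ≤ M x) (hMa : AntitoneOn M (Ioi 0)) : CoreConcl L p M := by
  set f0 : ℝ → ℝ := fun x => x / (1 + M x) with hf0
  have hf0d : DR L f0 := by simp (maxDischargeDepth := 99) [DR, hf0, hO, hM.app]
  have hf0M : ∀ x, 0 < x → f0 x * M x ≤ x := by
    intro x hx
    have := hM0 x
    rw [hf0]; dsimp only
    rw [div_mul_eq_mul_div, div_le_iff₀ (by linarith)]
    nlinarith
  have hpos : ∀ x, 0 < x → 0 < f0 x := fun x hx => div_pos hx (by linarith [hM0 x])
  by_cases hc : ∃ N : ℕ, ∀ᶠ x in 𝓝[>] (0:ℝ), x ^ N ≤ f0 x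
  · obtain ⟨N, hN⟩ := hc
    obtain ⟨d, hd, h1⟩ := ev_iff.1 hN
    set n := N + p + 2 with hn
    refine ⟨fun x => x ^ n, min d 1, ∑ j ∈ Finset.range (p + 1), |∏ i ∈ Finset.range j, ((n : ℝ) - i)|, by positivity, ?_, ?_, ?_, ?_, ?_, ?_⟩
    · simp (maxDischargeDepth := 99) [DR, hO]
    · exact (contDiff_id.pow n).contDiffOn
    · intro x hx y hy hxy
      exact pow_lt_pow_left₀ hxy hx.1.le (by omega)
    · intro x hx; have := hx.1; positivity
    · intro j hj x hx
      rw [iteratedDeriv_eq_iterate, iter_deriv_pow]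
      have hx0 := hx.1
      have hx1 : x ≤ 1 := (hx.2.trans_le (min_le_right _ _)).le
      rw [abs_mul, abs_of_nonneg (pow_nonneg hx0.le _)]
      have h2 : x ^ (n - j) ≤ x ^ 2 := pow_le_pow_of_le_one hx0.le hx1 (by omega)
      have h3 : |∏ i ∈ Finset.range j, ((n : ℝ) - i)| ≤
          ∑ j ∈ Finset.range (p + 1), |∏ i ∈ Finset.range j, ((n : ℝ) - i)| :=
        Finset.single_le_sum (f := fun j => |∏ i ∈ Finset.range j, ((n : ℝ) - i)|)
          (fun _ _ => abs_nonneg _) (Finset.mem_range.2 (by omega))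
      gcongr
    · intro x hx
      have hx0 := hx.1
      have hx1 : x ≤ 1 := (hx.2.trans_le (min_le_right _ _)).le
      have h2 : x ^ n ≤ x ^ N := pow_le_pow_of_le_one hx0.le hx1 (by omega)
      exact (mul_le_mul_of_nonneg_right (h2.trans (h1 x hx0 (hx.2.trans_le (min_le_left _ _)))) (hM0 x)).trans
        (hf0M x hx0)
  · have hFF : FF L f0 := by
      refine ⟨hf0d, fun N => ?_⟩
      rcases hT (fun x => x ^ N ≤ f0 x) (by simp (maxDischargeDepth := 99) [DS, hO, hf0d.app]) with h | h
      · exact absurd ⟨N, ev_iff.2 h⟩ hc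
      · obtain ⟨d, hd, h1⟩ := h
        refine ev_iff.2 ⟨d, hd, fun t h2 h3 => ?_⟩
        rw [abs_of_pos (hpos t h2)]
        exact (not_le.1 (h1 t h2 h3)).le
    obtain ⟨δ, hδ, h1, h2⟩ := hFF.cd hT hO p
    refine ⟨f0, δ, 1, hδ, hf0d, h1, ?_, fun x hx => hpos x hx.1, ?_, fun x hx => hf0M x hx.1⟩
    · intro x hx y hy hxy
      have := hMa (mem_Ioi.2 hx.1) (mem_Ioi.2 hy.1) hxy.le
      exact div_lt_div₀ hxy (by linarith) (hy.1.le) (by linarith [hM0 y])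
    · simpa using h2
end triv4

theorem discrete_gap {n : ℕ} (D : Fin n → Set ℝ) (hD : ∀ i, IsDiscreteSet (D i)) (I : Finset (Fin n)) :
    ∀ u v : ℝ, u < v → ∃ u' v', u ≤ u' ∧ u' < v' ∧ v' ≤ v ∧ ∀ i ∈ I, ∀ x ∈ Ioo u' v', x ∉ D i := by
  induction I using Finset.induction_on with
  | empty => intro u v h; exact ⟨u, v, le_rfl, h, le_rfl, by simp⟩
  | insert j I _ ih =>
    intro u v huv
    obtain ⟨a, b, h1, h2, h3, h4⟩ := ih u v huv
    by_cases hx : ∃ x ∈ Ioo a b, x ∈ D j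
    · obtain ⟨x, hxab, hxD⟩ := hx
      obtain ⟨U, hU, hUD⟩ := hD j x hxD
      have hxU : x ∈ U := by
        have : x ∈ U ∩ D j := by rw [hUD]; rfl
        exact this.1
      obtain ⟨e, he, hb⟩ := Metric.isOpen_iff.1 hU x hxU
      refine ⟨x, min b (x + e), h1.trans hxab.1.le, lt_min hxab.2 (by linarith), (min_le_left _ _).trans h3, ?_⟩
      intro i hi y hy
      have hyb : y < b := hy.2.trans_le (min_le_left _ _)
      have hye : y < x + e := hy.2.trans_le (min_le_right _ _)
      rcases Finset.mem_insert.1 hi with rfl | hi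
      · intro hyD
        have : y ∈ U ∩ D i := ⟨hb (by rw [Metric.mem_ball, Real.dist_eq, abs_lt]; constructor <;> linarith [hy.1]), hyD⟩
        rw [hUD] at this
        exact absurd hy.1 (by rw [mem_singleton_iff.1 this]; exact lt_irrefl _)
      · exact h4 i hi y ⟨hxab.1.trans hy.1, hyb⟩
    · push Not at hx
      refine ⟨a, b, h1, h2, h3, fun i hi y hy => ?_⟩
      rcases Finset.mem_insert.1 hi with rfl | hi
      · exact hx y hy
      · exact h4 i hi y hy

section p5
variable {L}
theorem frontier_gap (hL : DMinimal L) {S : ℝ → Prop} (hS : DS L S) {u v : ℝ} (huv : u < v) :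
    ∃ x ∈ Ioo u v, x ∉ frontier {t | S t} := by
  by_contra hcon
  push Not at hcon
  obtain ⟨N, hN⟩ := hL.2 0 {w | S (w (Sum.inr ()))} (DS.app hS (Df_var _))
  obtain ⟨U, D, hU, hD, hE⟩ := hN (fun i => i.elim0)
  have hE' : {t | S t} = U ∪ ⋃ i, D i := by rw [← hE]; rfl
  obtain ⟨a, b, h1, h2, h3, h4⟩ := discrete_gap D hD Finset.univ u v huv
  obtain ⟨x, hx⟩ := exists_between h2
  have hxf := hcon x ⟨h1.trans_lt hx.1, hx.2.trans_le h3⟩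
  obtain ⟨y, hy, hyS⟩ := mem_closure_iff.1 hxf.1 (Ioo a b) isOpen_Ioo hx
  rw [hE'] at hyS
  rcases hyS with hyU | hyD
  · refine (hcon y ⟨h1.trans_lt hy.1, hy.2.trans_le h3⟩).2 ?_
    rw [mem_interior]
    exact ⟨U, by rw [hE']; exact subset_union_left, hU, hyU⟩
  · obtain ⟨i, hi⟩ := mem_iUnion.1 hyD
    exact h4 i (Finset.mem_univ _) y hy hi

theorem mem_frontier_eps {S : ℝ → Prop} {x : ℝ} : x ∈ frontier {t | S t} ↔
    ∀ d, 0 < d → (∃ y, |x - y| < d ∧ S y) ∧ (∃ y, |x - y| < d ∧ ¬ S y) := by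
  rw [frontier_eq_closure_inter_closure, mem_inter_iff, Metric.mem_closure_iff, Metric.mem_closure_iff]
  simp only [Real.dist_eq]
  constructor
  · rintro ⟨h1, h2⟩ d hd
    obtain ⟨y, hy, h⟩ := h1 d hd
    obtain ⟨z, hz, h'⟩ := h2 d hd
    exact ⟨⟨y, h, hy⟩, z, h', hz⟩
  · intro h
    refine ⟨fun d hd => ?_, fun d hd => ?_⟩
    · obtain ⟨y, h1, h2⟩ := (h d hd).1; exact ⟨y, h2, h1⟩
    · obtain ⟨y, h1, h2⟩ := (h d hd).2; exact ⟨y, h2, h1⟩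

theorem exists_D (hL : DMinimal L) (hT : ¬ Triv L) : ∃ D : ℝ → Prop, DS L D ∧ (∀ x, D x → 0 < x) ∧
    (∀ c, 0 < c → ∃ x, D x ∧ x < c) ∧
    (∀ c, 0 < c → ∃ l, 0 < l ∧ ∀ a a', D a → D a' → c ≤ a → a < a' → a + l ≤ a') := by
  have hO := hL.1
  unfold Triv at hT
  push Not at hT
  obtain ⟨S, hS, h1, h2⟩ := hT
  set B : ℝ → Prop := fun x => x ∈ frontier {t | S t} with hB
  have hBd : DS L B := by
    simp only [hB, DS, mem_frontier_eps]
    simp (maxDischargeDepth := 99) [hO, hS.app]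
  have hBc : IsClosed {x | B x} := isClosed_frontier
  have hBacc : ∀ c, 0 < c → ∃ x, B x ∧ 0 < x ∧ x < c := by
    intro c hc
    obtain ⟨t1, a1, a2, a3⟩ := h1 c hc
    obtain ⟨t2, b1, b2, b3⟩ := h2 c hc
    have hpc : IsPreconnected (Ioo 0 c) := isPreconnected_Ioo
    by_contra hcon
    push Not at hcon
    have hnf : ∀ x ∈ Ioo 0 c, x ∈ interior {t | S t} ∨ x ∈ interior {t | S t}ᶜ := by
      intro x hx
      have h := hcon x
      by_contra h'
      push Not at h'
      refine absurd hx.2 (not_lt.2 (h ?_ hx.1))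
      have h3 := h'.2
      rw [interior_compl, mem_compl_iff, not_not] at h3
      exact ⟨h3, h'.1⟩
    obtain ⟨x, hx, hx1, hx2⟩ := hpc (interior {t | S t}) (interior {t | S t}ᶜ) isOpen_interior isOpen_interior
      (fun x hx => hnf x hx)
      ⟨t2, ⟨b1, b2⟩, (hnf t2 ⟨b1, b2⟩).resolve_right (fun h => interior_subset h b3)⟩
      ⟨t1, ⟨a1, a2⟩, (hnf t1 ⟨a1, a2⟩).resolve_left (fun h => a3 (interior_subset (s := {t | S t}) h))⟩
    exact interior_subset hx2 (interior_subset (s := {t | S t}) hx1)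
  -- gaps
  set G : ℝ → ℝ → Prop := fun a b => 0 < a ∧ a < b ∧ B a ∧ B b ∧ ∀ x, a < x → x < b → ¬ B x with hG
  have hGex : ∀ c, 0 < c → ∃ a b, G a b ∧ b < c := by
    intro c hc
    obtain ⟨β, hβ, hβ0, hβc⟩ := hBacc c hc
    obtain ⟨α, hα, hα0, hαβ⟩ := hBacc β hβ0
    obtain ⟨v, hv, hvB⟩ := frontier_gap hL hS hαβ
    have c1 : IsCompact ({x | B x} ∩ Icc α v) := isCompact_Icc.inter_left hBc
    have c2 : IsCompact ({x | B x} ∩ Icc v β) := isCompact_Icc.inter_left hBc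
    obtain ⟨a, ha, ha'⟩ := c1.exists_isGreatest ⟨α, hα, le_rfl, hv.1.le⟩
    obtain ⟨b, hb, hb'⟩ := c2.exists_isLeast ⟨β, hβ, hv.2.le, le_rfl⟩
    have hav : a < v := lt_of_le_of_ne ha.2.2 (fun h => hvB (h ▸ ha.1))
    have hvb : v < b := lt_of_le_of_ne hb.2.1 (fun h => hvB (h ▸ hb.1))
    refine ⟨a, b, ⟨hα0.trans_le ha.2.1, hav.trans hvb, ha.1, hb.1, fun x hx1 hx2 hxB => ?_⟩,
      hb.2.2.trans_lt hβc⟩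
    rcases le_total x v with h | h
    · exact absurd (ha' ⟨hxB, ha.2.1.trans hx1.le, h⟩) (not_le.2 hx1)
    · exact absurd (hb' ⟨hxB, h, hx2.le.trans hb.2.2⟩) (not_le.2 hx2)
  -- record gaps
  set R : ℝ → ℝ → Prop := fun a b => G a b ∧ ∀ a' b', G a' b' → b' ≤ a → b' - a' < b - a with hR
  have hRex : ∀ c, 0 < c → ∃ a b, R a b ∧ b < c := by
    intro c hc
    by_contra hcon
    push Not at hcon
    obtain ⟨a0, b0, hG0, hb0⟩ := hGex c hc
    set l := b0 - a0 with hl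
    have hlpos : 0 < l := by have := hG0.2.1; linarith
    have ind : ∀ k : ℕ, ∃ a b, G a b ∧ b < c - k * l ∧ l ≤ b - a := by
      intro k
      induction k with
      | zero => exact ⟨a0, b0, hG0, by simpa using hb0, le_rfl⟩
      | succ k ih =>
        obtain ⟨a, b, h3, h4, h5⟩ := ih
        have : ¬ R a b := fun h => by
          have := hcon a b h
          have : (0:ℝ) ≤ k * l := by positivity
          linarith
        simp only [hR, not_and] at this
        have := this h3
        push Not at this
        obtain ⟨a', b', h6, h7, h8⟩ := this
        refine ⟨a', b', h6, ?_, h5.trans h8⟩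
        push_cast
        linarith
    obtain ⟨k, hk⟩ := exists_nat_gt (c / l)
    obtain ⟨a, b, h3, h4, h5⟩ := ind k
    rw [div_lt_iff₀ hlpos] at hk
    have := h3.1
    have := h3.2.1
    linarith
  refine ⟨fun a => ∃ b, R a b, ?_, ?_, ?_, ?_⟩
  · simp only [hR, hG, DS]
    clear_value B
    simp (maxDischargeDepth := 99) [hO, hBd.app]
  · rintro x ⟨b, h⟩; exact h.1.1
  · intro c hc
    obtain ⟨a, b, h, hb⟩ := hRex c hc
    exact ⟨a, ⟨b, h⟩, h.1.2.1.trans hb⟩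
  · intro c hc
    obtain ⟨a0, b0, h, hb⟩ := hRex c hc
    refine ⟨b0 - a0, by have := h.1.2.1; linarith, ?_⟩
    rintro a a' ⟨b, hab⟩ ⟨b', hab'⟩ hca haa'
    have h3 := hab.2 a0 b0 h.1 (by linarith)
    have h4 : b ≤ a' := by
      by_contra h5
      exact hab.1.2.2.2.2 a' haa' (not_le.1 h5) hab'.1.2.2.1
    linarith
end p5

theorem hasDerivAt_posPow (k : ℕ) (t : ℝ) :
    HasDerivAt (fun t : ℝ => max t 0 ^ (k + 2)) ((k + 2) * max t 0 ^ (k + 1)) t := by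
  rcases lt_trichotomy t 0 with h | h | h
  · have : (fun t : ℝ => max t 0 ^ (k + 2)) =ᶠ[𝓝 t] fun _ => 0 := by
      filter_upwards [Iio_mem_nhds h] with s hs
      rw [max_eq_right (le_of_lt hs)]; simp
    rw [max_eq_right h.le]
    simpa using (hasDerivAt_const t (0:ℝ)).congr_of_eventuallyEq this
  · subst h
    rw [hasDerivAt_iff_eps]
    intro e he
    refine ⟨min e 1, by positivity, fun y hy => ?_⟩
    have h1 : |y| < e := by simpa using hy.trans_le (min_le_left _ _)
    have h2 : |y| < 1 := by simpa using hy.trans_le (min_le_right _ _)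
    simp only [max_self, sub_zero]
    have h0 : 0 ≤ max y 0 := le_max_right _ _
    have h3 : max y 0 ≤ |y| := max_le (le_abs_self y) (abs_nonneg y)
    have h4 : max y 0 ^ (k + 2) ≤ |y| ^ 2 := by
      calc max y 0 ^ (k + 2) ≤ |y| ^ (k + 2) := by gcongr
        _ ≤ |y| ^ 2 := pow_le_pow_of_le_one (abs_nonneg y) h2.le (by omega)
    have h5 : max y 0 ^ (k + 2) - (0:ℝ) ^ (k + 2) - y * ((k + 2) * (0:ℝ) ^ (k + 1)) = max y 0 ^ (k + 2) := by simp
    rw [h5, abs_of_nonneg (by positivity)]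
    nlinarith [abs_nonneg y]
  · have : (fun t : ℝ => max t 0 ^ (k + 2)) =ᶠ[𝓝 t] fun t => t ^ (k + 2) := by
      filter_upwards [Ioi_mem_nhds h] with s hs
      rw [max_eq_left (le_of_lt hs)]
    rw [max_eq_left h.le]
    have h2 := (hasDerivAt_pow (k + 2) t).congr_of_eventuallyEq this
    have e : ((k:ℝ) + 2) * t ^ (k + 1) = ((k + 2 : ℕ) : ℝ) * t ^ (k + 2 - 1) := by
      push_cast; rfl
    rw [e]
    exact h2

theorem contDiff_posPow (k : ℕ) : ContDiff ℝ k (fun t : ℝ => max t 0 ^ (k + 1)) := by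
  induction k with
  | zero =>
    simp only [Nat.cast_zero, contDiff_zero]
    fun_prop
  | succ k ih =>
    have : ((k + 1 : ℕ) : WithTop ℕ∞) = (k : WithTop ℕ∞) + 1 := by push_cast; rfl
    rw [this, contDiff_succ_iff_deriv]
    refine ⟨fun t => (hasDerivAt_posPow k t).differentiableAt, by simp, ?_⟩
    have : deriv (fun t : ℝ => max t 0 ^ (k + 1 + 1)) = fun t : ℝ => ((k:ℝ) + 2) * max t 0 ^ (k + 1) := by
      ext t; exact (hasDerivAt_posPow k t).deriv
    rw [this]
    exact contDiff_const.mul ih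

/-- C^p step function -/
def stp (p : ℕ) (t : ℝ) : ℝ := max t 0 ^ (p + 1) / (max t 0 ^ (p + 1) + max (1 - t) 0 ^ (p + 1))

theorem stp_den (p : ℕ) (t : ℝ) : 0 < max t 0 ^ (p + 1) + max (1 - t) 0 ^ (p + 1) := by
  have h1 : 0 ≤ max t 0 := le_max_right _ _
  have h2 : 0 ≤ max (1 - t) 0 := le_max_right _ _
  rcases lt_or_ge 0 t with h | h
  · have : 0 < max t 0 := lt_max_of_lt_left h
    positivity
  · have : 0 < max (1 - t) 0 := lt_max_of_lt_left (by linarith)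
    positivity

theorem stp_contDiff (p : ℕ) : ContDiff ℝ p (stp p) := by
  have h := contDiff_posPow p
  have h2 : ContDiff ℝ p (fun t : ℝ => max (1 - t) 0 ^ (p + 1)) :=
    h.comp (contDiff_const.sub contDiff_id)
  exact h.div (h.add h2) (fun t => (stp_den p t).ne')

theorem stp_zero (p : ℕ) {t : ℝ} (ht : t ≤ 0) : stp p t = 0 := by
  simp [stp, max_eq_right ht]
theorem stp_one (p : ℕ) {t : ℝ} (ht : 1 ≤ t) : stp p t = 1 := by
  have := stp_den p t
  have h : max (1 - t) 0 = 0 := max_eq_right (by linarith)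
  unfold stp
  rw [h] at this ⊢
  simp only [ne_eq, Nat.add_eq_zero_iff, one_ne_zero, and_false, not_false_eq_true, zero_pow, add_zero] at this ⊢
  exact div_self this.ne'
theorem stp_strict (p : ℕ) {s t : ℝ} (hs : 0 ≤ s) (hst : s < t) (ht : t ≤ 1) : stp p s < stp p t := by
  unfold stp
  rw [div_lt_div_iff₀ (stp_den p s) (stp_den p t)]
  rw [max_eq_left hs, max_eq_left (hs.trans hst.le), max_eq_left (by linarith : 0 ≤ 1 - s),
    max_eq_left (by linarith : 0 ≤ 1 - t)]
  have a1 : s ^ (p + 1) ≤ t ^ (p + 1) := by gcongr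
  have a2 : (1 - t) ^ (p + 1) < (1 - s) ^ (p + 1) :=
    pow_lt_pow_left₀ (by linarith) (by linarith) (by omega)
  have a3 : 0 < t ^ (p + 1) := pow_pos (hs.trans_lt hst) _
  have a4 : 0 ≤ (1 - t) ^ (p + 1) := pow_nonneg (by linarith) _
  nlinarith
theorem stp_nonneg (p : ℕ) (t : ℝ) : 0 ≤ stp p t := by
  have := stp_den p t
  unfold stp
  have h1 : 0 ≤ max t 0 := le_max_right _ _
  positivity
theorem stp_lt_one (p : ℕ) {t : ℝ} (ht : t < 1) : stp p t < 1 := by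
  unfold stp
  rw [div_lt_one (stp_den p t)]
  have : 0 < max (1 - t) 0 := lt_max_of_lt_left (by linarith)
  have := pow_pos this (p + 1)
  linarith

theorem stp_bound_one (p j : ℕ) (hj : j ≤ p) : ∃ K, ∀ t, |iteratedDeriv j (stp p) t| ≤ K := by
  have hc : Continuous (iteratedDeriv j (stp p)) :=
    (stp_contDiff p).continuous_iteratedDeriv j (by exact_mod_cast hj)
  obtain ⟨K, hK⟩ := (isCompact_Icc (a := (-1:ℝ)) (b := 2)).exists_bound_of_continuousOn hc.continuousOn
  refine ⟨max K 1, fun t => ?_⟩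
  have key : ∀ c : ℝ, |c| ≤ 1 → stp p =ᶠ[𝓝 t] (fun _ => c) → |iteratedDeriv j (stp p) t| ≤ max K 1 := by
    intro c hc h
    rw [h.iteratedDeriv_eq, iteratedDeriv_const]
    split_ifs
    · exact hc.trans (le_max_right _ _)
    · simp
  by_cases h1 : t < 0
  · refine key 0 (by simp) ?_
    filter_upwards [Iio_mem_nhds h1] with s hs using stp_zero p (le_of_lt hs)
  by_cases h2 : 1 < t
  · refine key 1 (by simp) ?_
    filter_upwards [Ioi_mem_nhds h2] with s hs using stp_one p (le_of_lt hs)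
  · push Not at h1 h2
    exact (hK t ⟨by linarith, by linarith⟩).trans (le_max_left _ _)

theorem stp_bound (p : ℕ) : ∃ K, 0 ≤ K ∧ ∀ j ≤ p, ∀ t, |iteratedDeriv j (stp p) t| ≤ K := by
  have : ∀ j : ℕ, ∃ K, 0 ≤ K ∧ (j ≤ p → ∀ t, |iteratedDeriv j (stp p) t| ≤ K) := by
    intro j
    by_cases hj : j ≤ p
    · obtain ⟨K, hK⟩ := stp_bound_one p j hj
      exact ⟨K, (abs_nonneg _).trans (hK 0), fun _ => hK⟩
    · exact ⟨0, le_rfl, fun h => absurd h hj⟩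
  choose K h0 hK using this
  refine ⟨∑ j ∈ Finset.range (p + 1), K j, Finset.sum_nonneg (fun j _ => h0 j), fun j hj t => ?_⟩
  exact (hK j hj t).trans (Finset.single_le_sum (f := K) (fun i _ => h0 i) (Finset.mem_range.2 (by omega)))

theorem stp_scaled (p j : ℕ) (hj : j ≤ p) (s r A y : ℝ) :
    iteratedDeriv j (fun y => A * stp p (s * (y - r))) y = A * (s ^ j * iteratedDeriv j (stp p) (s * (y - r))) := by
  have h0 := stp_contDiff p
  have h0' : ContDiff ℝ j (stp p) := h0.of_le (by exact_mod_cast hj)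
  have h1 : ContDiff ℝ j (fun y => stp p (s * y)) := h0'.comp (contDiff_const.mul contDiff_id)
  have h2 : ContDiff ℝ j (fun y => stp p (s * (y - r))) := h1.comp (contDiff_id.sub contDiff_const)
  rw [iteratedDeriv_const_mul_field]
  rw [iteratedDeriv_comp_sub_const j (fun y => stp p (s * y)) r]
  simp only
  rw [iteratedDeriv_comp_const_mul h0' s]

section p6
variable {L}
theorem DR_stp (hO : ExpandsOrderedField L) (p : ℕ) : DR L (stp p) := by
  simp only [DR, stp]
  simp (maxDischargeDepth := 99) [hO]
end p6

section p7
/-- predecessor, weak -/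
def preD (D : ℝ → Prop) (x : ℝ) : ℝ := sSup {d | D d ∧ d ≤ x}
/-- predecessor, strict -/
def qD (D : ℝ → Prop) (x : ℝ) : ℝ := sSup {d | D d ∧ d < x}
/-- successor -/
def sucD (D : ℝ → Prop) (x : ℝ) : ℝ := sInf {d | D d ∧ x < d}
/-- minimal gap -/
def lamD (D : ℝ → Prop) (x : ℝ) : ℝ :=
  sInf {r | r = 1 ∨ ∃ a a', D a ∧ D a' ∧ x ≤ a ∧ a < a' ∧ r = a' - a}
/-- heights -/
def etaD (D : ℝ → Prop) (p : ℕ) (M : ℝ → ℝ) (x : ℝ) : ℝ :=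
  x * (lamD D (qD D x) ^ p * qD D x ^ 2 / (1 + M (qD D x)))
/-- interpolation -/
def fD (D : ℝ → Prop) (p : ℕ) (M : ℝ → ℝ) (x : ℝ) : ℝ :=
  etaD D p M (preD D x) + (etaD D p M (sucD D x) - etaD D p M (preD D x)) *
    stp p ((sucD D x - preD D x)⁻¹ * (x - preD D x))

variable {D : ℝ → Prop} (hpos : ∀ x, D x → 0 < x) (hacc : ∀ c, 0 < c → ∃ x, D x ∧ x < c)
  (hsep : ∀ c, 0 < c → ∃ l, 0 < l ∧ ∀ a a', D a → D a' → c ≤ a → a < a' → a + l ≤ a')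
include hpos hacc hsep

theorem D_greatest {T : Set ℝ} (hT : ∀ t ∈ T, D t) (hne : T.Nonempty) (hb : BddAbove T) :
    ∃ m, IsGreatest T m := by
  obtain ⟨d0, h0⟩ := hne
  obtain ⟨l, hl, h⟩ := hsep d0 (hpos _ (hT _ h0))
  have hL := isLUB_csSup ⟨d0, h0⟩ hb
  set s := sSup T
  rcases eq_or_lt_of_le (hL.1 h0) with h1 | h1
  · exact ⟨d0, h0, fun t ht => (hL.1 ht).trans h1.symm.le⟩
  · have h2 : max (s - l) d0 < s := max_lt (by linarith) h1
    obtain ⟨d, hd, h3, h4⟩ := hL.exists_between h2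
    refine ⟨d, hd, fun t ht => ?_⟩
    by_contra h5
    have h6 := h d t (hT _ hd) (hT _ ht) ((le_max_right _ _).trans h3.le) (not_le.1 h5)
    have := hL.1 ht
    have := (le_max_left (s - l) d0).trans_lt h3
    linarith

theorem D_least {T : Set ℝ} (hT : ∀ t ∈ T, D t) (hne : T.Nonempty) {x : ℝ} (hx : 0 < x)
    (hb : ∀ t ∈ T, x ≤ t) : ∃ m, IsLeast T m := by
  obtain ⟨l, hl, h⟩ := hsep x hx
  have hL := isGLB_csInf hne ⟨x, hb⟩
  set s := sInf T
  obtain ⟨d, hd, h3, h4⟩ := hL.exists_between (show s < s + l by linarith)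
  refine ⟨d, hd, fun t ht => ?_⟩
  by_contra h5
  have h6 := h t d (hT _ ht) (hT _ hd) (hb _ ht) (not_le.1 h5)
  have := hL.1 ht
  linarith

omit hpos hacc hsep in
theorem preD_eq {u y : ℝ} (hu : D u) (h1 : u ≤ y) (hn : ∀ d, D d → u < d → ¬ d ≤ y) : preD D y = u :=
  IsGreatest.csSup_eq ⟨⟨hu, h1⟩, fun d hd => by
    by_contra h; exact hn d hd.1 (not_le.1 h) hd.2⟩
omit hpos hacc hsep in
theorem qD_eq {u y : ℝ} (hu : D u) (h1 : u < y) (hn : ∀ d, D d → u < d → ¬ d < y) : qD D y = u :=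
  IsGreatest.csSup_eq ⟨⟨hu, h1⟩, fun d hd => by
    by_contra h; exact hn d hd.1 (not_le.1 h) hd.2⟩
omit hpos hacc hsep in
theorem sucD_eq {u y : ℝ} (hu : D u) (h1 : y < u) (hn : ∀ d, D d → y < d → ¬ d < u) : sucD D y = u :=
  IsLeast.csInf_eq ⟨⟨hu, h1⟩, fun d hd => by
    by_contra h; exact hn d hd.1 hd.2 (not_le.1 h)⟩

theorem cell {e x : ℝ} (he : D e) (hx : 0 < x) (hxe : x < e) : ∃ b c, D b ∧ D c ∧ b ≤ x ∧ x < c ∧ c ≤ e ∧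
    ∀ d, D d → b < d → ¬ d < c := by
  obtain ⟨d0, h0, h0'⟩ := hacc x hx
  obtain ⟨b, hb, hb'⟩ := D_greatest hpos hacc hsep (T := {d | D d ∧ d ≤ x}) (fun t ht => ht.1)
    ⟨d0, h0, h0'.le⟩ ⟨x, fun t ht => ht.2⟩
  obtain ⟨c, hc, hc'⟩ := D_least hpos hacc hsep (T := {d | D d ∧ x < d}) (fun t ht => ht.1)
    ⟨e, he, hxe⟩ hx (fun t ht => ht.2.le)
  refine ⟨b, c, hb.1, hc.1, hb.2, hc.2, hc' ⟨he, hxe⟩, fun d hd h1 h2 => ?_⟩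
  rcases le_or_gt d x with h | h
  · exact absurd (hb' ⟨hd, h⟩) (not_le.2 h1)
  · exact absurd (hc' ⟨hd, h⟩) (not_le.2 h2)

theorem qD_spec {x : ℝ} (hx : 0 < x) : IsGreatest {d | D d ∧ d < x} (qD D x) := by
  obtain ⟨d0, h0, h0'⟩ := hacc x hx
  obtain ⟨b, hb⟩ := D_greatest hpos hacc hsep (T := {d | D d ∧ d < x}) (fun t ht => ht.1)
    ⟨d0, h0, h0'⟩ ⟨x, fun t ht => ht.2.le⟩
  unfold qD
  rwa [hb.csSup_eq]

omit hpos hacc hsep in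
theorem lamD_bdd (x : ℝ) : (0:ℝ) ∈ lowerBounds {r | r = 1 ∨ ∃ a a', D a ∧ D a' ∧ x ≤ a ∧ a < a' ∧ r = a' - a} := by
  rintro r (rfl | ⟨a, a', h1, h2, h3, h4, rfl⟩)
  · norm_num
  · linarith

omit hpos hacc in
theorem lamD_pos {x : ℝ} (hx : 0 < x) : 0 < lamD D x := by
  obtain ⟨l, hl, h⟩ := hsep x hx
  refine lt_of_lt_of_le (lt_min hl one_pos) (le_csInf ⟨1, Or.inl rfl⟩ ?_)
  rintro r (rfl | ⟨a, a', h1, h2, h3, h4, rfl⟩)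
  · exact min_le_right _ _
  · have := h a a' h1 h2 h3 h4
    exact (min_le_left _ _).trans (by linarith)
omit hpos hacc hsep in
theorem lamD_le_one (x : ℝ) : lamD D x ≤ 1 := csInf_le ⟨0, lamD_bdd x⟩ (Or.inl rfl)
omit hpos hacc hsep in
theorem lamD_le {a a' : ℝ} (h : D a) (h' : D a') (hl : a < a') : lamD D a ≤ a' - a :=
  csInf_le ⟨0, lamD_bdd a⟩ (Or.inr ⟨a, a', h, h', le_rfl, hl, rfl⟩)
omit hpos hacc hsep in
theorem lamD_mono {x y : ℝ} (h : x ≤ y) : lamD D x ≤ lamD D y := by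
  refine csInf_le_csInf ⟨0, lamD_bdd x⟩ ⟨1, Or.inl rfl⟩ ?_
  rintro r (rfl | ⟨a, a', h1, h2, h3, h4, rfl⟩)
  · exact Or.inl rfl
  · exact Or.inr ⟨a, a', h1, h2, h.trans h3, h4, rfl⟩

variable {M : ℝ → ℝ} (hM0 : ∀ x, 0 ≤ M x) (hMa : AntitoneOn M (Ioi 0))
include hM0

theorem etaD_pos (p : ℕ) {x : ℝ} (hx : 0 < x) : 0 < etaD D p M x := by
  have h1 := qD_spec hpos hacc hsep hx
  have h2 : 0 < qD D x := hpos _ h1.1.1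
  have h3 := lamD_pos hsep h2
  have := hM0 (qD D x)
  unfold etaD
  positivity

include hMa in
theorem etaD_lt (p : ℕ) {x y : ℝ} (hx : 0 < x) (hxy : x < y) : etaD D p M x < etaD D p M y := by
  have h1 := qD_spec hpos hacc hsep hx
  have h2 := qD_spec hpos hacc hsep (hx.trans hxy)
  have h1' : 0 < qD D x := hpos _ h1.1.1
  have h2' : 0 < qD D y := hpos _ h2.1.1
  have hq : qD D x ≤ qD D y := h2.2 ⟨h1.1.1, h1.1.2.trans hxy⟩
  have h3 := lamD_pos hsep h1'
  have h4 := lamD_mono (D := D) hq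
  have m1 := hM0 (qD D x)
  have m2 := hM0 (qD D y)
  have m3 := hMa h1' h2' hq
  unfold etaD
  have : lamD D (qD D x) ^ p * qD D x ^ 2 / (1 + M (qD D x)) ≤
      lamD D (qD D y) ^ p * qD D y ^ 2 / (1 + M (qD D y)) := by
    have h6 := h3.trans_le h4
    gcongr
  have h5 : 0 < lamD D (qD D x) ^ p * qD D x ^ 2 / (1 + M (qD D x)) := by positivity
  nlinarith

/-- eta bound at c with predecessor b -/
theorem etaD_le (p : ℕ) {b c : ℝ} (hb : D b) (hbc : b < c) (hc : c ≤ 1)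
    (hn : ∀ d, D d → b < d → ¬ d < c) : etaD D p M c ≤ lamD D b ^ p * b ^ 2 / (1 + M b) := by
  have hb0 := hpos _ hb
  have := lamD_pos hsep hb0
  have := hM0 b
  unfold etaD
  rw [qD_eq hb hbc hn]
  have : 0 ≤ lamD D b ^ p * b ^ 2 / (1 + M b) := by positivity
  nlinarith

omit hpos hacc hsep hM0 in
theorem fD_eq (p : ℕ) {b c x : ℝ} (hb : D b) (hc : D c) (hbx : b ≤ x) (hxc : x < c)
    (hn : ∀ d, D d → b < d → ¬ d < c) :
    fD D p M x = etaD D p M b + (etaD D p M c - etaD D p M b) * stp p ((c - b)⁻¹ * (x - b)) := by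
  unfold fD
  rw [preD_eq hb hbx (fun d hd h h' => hn d hd h (h'.trans_lt hxc)),
    sucD_eq hc hxc (fun d hd h => hn d hd (hbx.trans_lt h))]

include hMa
theorem fD_ge (p : ℕ) {b c x : ℝ} (hb : D b) (hc : D c) (hbx : b ≤ x) (hxc : x < c)
    (hn : ∀ d, D d → b < d → ¬ d < c) : etaD D p M b ≤ fD D p M x := by
  rw [fD_eq p hb hc hbx hxc hn]
  have := etaD_lt hpos hacc hsep hM0 hMa p (hpos _ hb) (hbx.trans_lt hxc)
  nlinarith [stp_nonneg p ((c - b)⁻¹ * (x - b))]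

theorem fD_lt (p : ℕ) {b c x : ℝ} (hb : D b) (hc : D c) (hbx : b ≤ x) (hxc : x < c)
    (hn : ∀ d, D d → b < d → ¬ d < c) : fD D p M x < etaD D p M c := by
  rw [fD_eq p hb hc hbx hxc hn]
  have := etaD_lt hpos hacc hsep hM0 hMa p (hpos _ hb) (hbx.trans_lt hxc)
  have h2 : (c - b)⁻¹ * (x - b) < 1 := by
    rw [inv_mul_lt_iff₀ (by linarith)]; linarith
  nlinarith [stp_lt_one p h2]

theorem fD_strict (p : ℕ) {e : ℝ} (he : D e) : StrictMonoOn (fD D p M) (Ioo 0 e) := by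
  intro x hx y hy hxy
  obtain ⟨b, c, hb, hc, hbx, hxc, hce, hn⟩ := cell hpos hacc hsep he hx.1 hx.2
  rcases lt_or_ge y c with hyc | hyc
  · rw [fD_eq p hb hc hbx hxc hn, fD_eq p hb hc (hbx.trans hxy.le) hyc hn]
    have := etaD_lt hpos hacc hsep hM0 hMa p (hpos _ hb) (hbx.trans_lt hxc)
    have hcb : 0 < (c - b)⁻¹ := inv_pos.2 (by linarith)
    have := stp_strict p (s := (c - b)⁻¹ * (x - b)) (t := (c - b)⁻¹ * (y - b))
      (mul_nonneg hcb.le (by linarith)) (mul_lt_mul_of_pos_left (by linarith) hcb)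
      (by rw [inv_mul_le_iff₀ (by linarith)]; linarith)
    nlinarith
  · obtain ⟨b', c', hb', hc', hbx', hxc', hce', hn'⟩ := cell hpos hacc hsep he hy.1 hy.2
    have hcb : c ≤ b' := by
      by_contra h
      exact hn' c hc (not_le.1 h) (hyc.trans_lt hxc')
    have h1 := fD_lt hpos hacc hsep hM0 hMa p hb hc hbx hxc hn
    have h2 := fD_ge hpos hacc hsep hM0 hMa p hb' hc' hbx' hxc' hn'
    rcases eq_or_lt_of_le hcb with h | h
    · subst h; linarith
    · have := etaD_lt hpos hacc hsep hM0 hMa p (hpos _ hc) h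
      linarith

theorem fD_M (p : ℕ) {e x : ℝ} (he : D e) (he1 : e ≤ 1) (hx : x ∈ Ioo 0 e) : 0 < fD D p M x ∧ fD D p M x * M x ≤ x := by
  obtain ⟨b, c, hb, hc, hbx, hxc, hce, hn⟩ := cell hpos hacc hsep he hx.1 hx.2
  have h1 := fD_lt hpos hacc hsep hM0 hMa p hb hc hbx hxc hn
  have h2 := fD_ge hpos hacc hsep hM0 hMa p hb hc hbx hxc hn
  have hb0 := hpos _ hb
  have h3 := etaD_pos hpos hacc hsep hM0 p hb0
  have h4 := etaD_le hpos hacc hsep hM0 p hb (hbx.trans_lt hxc) (hce.trans he1) hn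
  refine ⟨by linarith, ?_⟩
  have hm := hM0 b
  have hmx := hM0 x
  have h5 : M x ≤ M b := hMa hb0 hx.1 hbx
  have h6 : lamD D b ^ p ≤ 1 := pow_le_one₀ (lamD_pos hsep hb0).le (lamD_le_one _)
  have h7 : lamD D b ^ p * b ^ 2 / (1 + M b) ≤ b ^ 2 / (1 + M b) := by
    gcongr
    nlinarith [sq_nonneg b]
  calc fD D p M x * M x ≤ (b ^ 2 / (1 + M b)) * (1 + M b) := by
        apply mul_le_mul (by linarith) (by linarith) hmx (by positivity)
    _ = b ^ 2 := by field_simp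
    _ ≤ x := by nlinarith [hx.2]

theorem fD_diff (p : ℕ) {e x K : ℝ} (he : D e) (he1 : e ≤ 1) (hx : x ∈ Ioo 0 e)
    (hK0 : 0 ≤ K) (hK : ∀ j ≤ p, ∀ t, |iteratedDeriv j (stp p) t| ≤ K) :
    ContDiffAt ℝ p (fD D p M) x ∧ ∀ j ≤ p, |iteratedDeriv j (fD D p M) x| ≤ (1 + 2 * K) * x ^ 2 := by
  obtain ⟨b, c, hb, hc, hbx, hxc, hce, hn⟩ := cell hpos hacc hsep he hx.1 hx.2
  have hb0 := hpos _ hb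
  obtain ⟨⟨ha, hab⟩, hq⟩ := qD_spec hpos hacc hsep hb0
  set a := qD D b with hadef
  have hn' : ∀ d, D d → a < d → ¬ d < b := fun d hd h h' => absurd (hq ⟨hd, h'⟩) (not_le.2 h)
  have ha0 := hpos _ ha
  have hbc := hbx.trans_lt hxc
  set A := etaD D p M a
  set B := etaD D p M b
  set C := etaD D p M c
  have hA : 0 < A := etaD_pos hpos hacc hsep hM0 p ha0
  have hAB : A < B := etaD_lt hpos hacc hsep hM0 hMa p ha0 hab
  have hBC : B < C := etaD_lt hpos hacc hsep hM0 hMa p hb0 hbc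
  have est : ∀ u v : ℝ, D u → D v → u < v → v ≤ 1 → (∀ d, D d → u < d → ¬ d < v) →
      etaD D p M v ≤ u ^ 2 ∧ ∀ j ≤ p, etaD D p M v * ((v - u)⁻¹) ^ j ≤ u ^ 2 := by
    intro u v hu hv huv hv1 hnn
    have hu0 := hpos _ hu
    have h4 := etaD_le hpos hacc hsep hM0 p hu huv hv1 hnn
    have hl := lamD_pos hsep hu0
    have hl1 := lamD_le_one (D := D) u
    have hl2 := lamD_le hu hv huv
    have hm := hM0 u
    have h5 : etaD D p M v ≤ lamD D u ^ p * u ^ 2 := h4.trans (div_le_self (by positivity) (by linarith))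
    have h0 := etaD_pos hpos hacc hsep hM0 p (hu0.trans huv)
    have key : ∀ j ≤ p, etaD D p M v * ((v - u)⁻¹) ^ j ≤ u ^ 2 := by
      intro j hj
      have h6 : (v - u)⁻¹ ≤ (lamD D u)⁻¹ := inv_anti₀ hl hl2
      have h7 : 0 ≤ (v - u)⁻¹ := inv_nonneg.2 (by linarith)
      have h8 : lamD D u ^ p ≤ lamD D u ^ j := pow_le_pow_of_le_one hl.le hl1 hj
      calc etaD D p M v * ((v - u)⁻¹) ^ j ≤ (lamD D u ^ j * u ^ 2) * ((lamD D u)⁻¹) ^ j := by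
            apply mul_le_mul _ (by gcongr) (by positivity) (by positivity)
            exact h5.trans (by gcongr)
        _ = u ^ 2 := by rw [inv_pow]; field_simp
    exact ⟨by simpa using key 0 (Nat.zero_le _), key⟩
  have e1 := est a b ha hb hab (by linarith) hn'
  have e2 := est b c hb hc hbc (by linarith) hn
  set s := (b - a)⁻¹ with hs
  set t := (c - b)⁻¹ with ht
  have hs0 : 0 < s := inv_pos.2 (by linarith)
  have ht0 : 0 < t := inv_pos.2 (by linarith)
  have hev : fD D p M =ᶠ[𝓝 x] fun y => A + ((B - A) * stp p (s * (y - a)) + (C - B) * stp p (t * (y - b))) := by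
    filter_upwards [Ioo_mem_nhds (hab.trans_le hbx) hxc] with y hy
    rcases le_or_gt b y with h | h
    · rw [fD_eq p hb hc h hy.2 hn, stp_one p (t := s * (y - a))]
      · ring
      · rw [hs, inv_mul_eq_div, le_div_iff₀ (by linarith)]; linarith
    · rw [fD_eq p ha hb hy.1.le h hn', stp_zero p (t := t * (y - b))]
      · ring
      · exact mul_nonpos_of_nonneg_of_nonpos ht0.le (by linarith)
  have sc : ∀ A s r : ℝ, ContDiff ℝ p (fun y => A * stp p (s * (y - r))) := fun A s r =>
    contDiff_const.mul ((stp_contDiff p).comp (contDiff_const.mul (contDiff_id.sub contDiff_const)))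
  refine ⟨((contDiff_const.add ((sc _ _ _).add (sc _ _ _))).contDiffAt).congr_of_eventuallyEq hev, fun j hj => ?_⟩
  have sc' : ∀ A s r : ℝ, ContDiffAt ℝ j (fun y => A * stp p (s * (y - r))) x := fun A s r =>
    ((sc A s r).of_le (by exact_mod_cast hj)).contDiffAt
  rw [hev.iteratedDeriv_eq, iteratedDeriv_fun_add contDiffAt_const ((sc' _ _ _).add (sc' _ _ _)),
    iteratedDeriv_fun_add (sc' _ _ _) (sc' _ _ _), stp_scaled p j hj, stp_scaled p j hj, iteratedDeriv_const]
  set X := iteratedDeriv j (stp p) (s * (x - a))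
  set Y := iteratedDeriv j (stp p) (t * (x - b))
  have hX : |X| ≤ K := hK j hj _
  have hY : |Y| ≤ K := hK j hj _
  have hax : a ^ 2 ≤ x ^ 2 := by gcongr; linarith
  have hbx2 : b ^ 2 ≤ x ^ 2 := by gcongr
  have t1 : |if j = 0 then A else 0| ≤ x ^ 2 := by
    split_ifs
    · rw [abs_of_pos hA]; linarith [e1.1]
    · simp; positivity
  have t2 : |(B - A) * (s ^ j * X)| ≤ K * x ^ 2 := by
    rw [abs_mul, abs_mul, abs_of_pos (by linarith : 0 < B - A), abs_of_pos (pow_pos hs0 j), ← mul_assoc, mul_comm]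
    have h1 : (B - A) * s ^ j ≤ B * s ^ j := by gcongr; linarith
    have := e1.2 j hj
    apply mul_le_mul hX (by linarith) _ hK0
    have : 0 < B - A := by linarith
    positivity
  have t3 : |(C - B) * (t ^ j * Y)| ≤ K * x ^ 2 := by
    rw [abs_mul, abs_mul, abs_of_pos (by linarith : 0 < C - B), abs_of_pos (pow_pos ht0 j), ← mul_assoc, mul_comm]
    have h1 : (C - B) * t ^ j ≤ C * t ^ j := by gcongr; linarith
    have := e2.2 j hj
    apply mul_le_mul hY (by linarith) _ hK0
    have : 0 < C - B := by linarith
    positivity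
  calc _ ≤ |if j = 0 then A else 0| + (|(B - A) * (s ^ j * X)| + |(C - B) * (t ^ j * Y)|) :=
        (abs_add_le _ _).trans (by gcongr; exact abs_add_le _ _)
    _ ≤ _ := by linarith
end p7

section p7b
variable {L}
theorem DR_fD (hO : ExpandsOrderedField L) {D : ℝ → Prop} (hD : DS L D) (p : ℕ) {M : ℝ → ℝ} (hM : DR L M) :
    DR L (fD D p M) := by
  have h1 : DR L (preD D) := by
    simp only [DR, preD]; simp (maxDischargeDepth := 99) [hO, hD.app]
  have h2 : DR L (sucD D) := by
    simp only [DR, sucD]; simp (maxDischargeDepth := 99) [hO, hD.app]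
  have h3 : DR L (qD D) := by
    simp only [DR, qD]; simp (maxDischargeDepth := 99) [hO, hD.app]
  have h4 : DR L (lamD D) := by
    simp only [DR, lamD]
    refine Df_sInf hO (P := fun v r => r = 1 ∨ ∃ a a', D a ∧ D a' ∧ v () ≤ a ∧ a < a' ∧ r = a' - a) ?_
    simp (maxDischargeDepth := 99) [hO, hD.app]
  have h5 : DR L (etaD D p M) := by
    simp only [DR, etaD]; simp (maxDischargeDepth := 99) [hO, h3.app, h4.app, hM.app]
  have h6 := DR_stp hO p
  simp only [DR, fD]; simp (maxDischargeDepth := 99) [hO, h1.app, h2.app, h5.app, h6.app]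

theorem core_D (hL : DMinimal L) (hT : ¬ Triv L) (p : ℕ) {M : ℝ → ℝ} (hM : DR L M) (hM0 : ∀ x, 0 ≤ M x)
    (hMa : AntitoneOn M (Ioi 0)) : CoreConcl L p M := by
  obtain ⟨D, hD, hpos, hacc, hsep⟩ := exists_D hL hT
  obtain ⟨e, he, he1⟩ := hacc 1 one_pos
  obtain ⟨K, hK0, hK⟩ := stp_bound p
  have hdf := fun x hx => fD_diff hpos hacc hsep hM0 hMa p he he1.le (x := x) hx hK0 hK
  have hm := fun x hx => fD_M hpos hacc hsep hM0 hMa p he he1.le (x := x) hx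
  exact ⟨fD D p M, e, 1 + 2 * K, hpos _ he, DR_fD hL.1 hD p hM,
    fun x hx => (hdf x hx).1.contDiffWithinAt, fD_strict hpos hacc hsep hM0 hMa p he,
    fun x hx => (hm x hx).1, fun j hj x hx => (hdf x hx).2 j hj, fun x hx => (hm x hx).2⟩
end p7b

theorem flat_ext (p : ℕ) {δ C : ℝ} (hδ : 0 < δ) : ∀ (G : ℝ → ℝ),
    ContDiffOn ℝ p G (Ioo (-δ) δ \ {0}) →
    (∀ j ≤ p, ∀ x ∈ Ioo (-δ) δ, x ≠ 0 → |iteratedDeriv j G x| ≤ C * x ^ 2) → G 0 = 0 →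
    ContDiffOn ℝ p G (Ioo (-δ) δ) ∧ ∀ j ≤ p, iteratedDeriv j G 0 = 0 := by
  have ho : IsOpen (Ioo (-δ) δ \ {(0:ℝ)}) := isOpen_Ioo.sdiff isClosed_singleton
  have aux : ∀ G : ℝ → ℝ, (∀ x ∈ Ioo (-δ) δ, x ≠ 0 → |G x| ≤ C * x ^ 2) → G 0 = 0 → HasDerivAt G 0 0 := by
    intro G hG hG0
    rw [hasDerivAt_iff_eps]
    intro e he
    refine ⟨min δ (e / (|C| + 1)), by positivity, fun y hy => ?_⟩
    have h1 : |y| < δ := by simpa using hy.trans_le (min_le_left _ _)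
    have h2 : |y| < e / (|C| + 1) := by simpa using hy.trans_le (min_le_right _ _)
    rw [lt_div_iff₀ (by positivity)] at h2
    simp only [hG0, sub_zero, mul_zero]
    rcases eq_or_ne y 0 with rfl | hy0
    · simp [hG0]
    · have h3 := hG y (by rw [abs_lt] at h1; exact h1) hy0
      calc |G y| ≤ C * y ^ 2 := h3
        _ ≤ (|C| + 1) * |y| ^ 2 := by
            rw [sq_abs]; gcongr; linarith [le_abs_self C]
        _ ≤ e * |y| := by nlinarith [abs_nonneg y]
  induction p with
  | zero =>
    intro G h1 h2 h3
    have hd := aux G (fun x hx hx0 => by simpa using h2 0 le_rfl x hx hx0) h3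
    simp only [Nat.cast_zero, contDiffOn_zero] at h1 ⊢
    refine ⟨fun x hx => ?_, fun j hj => ?_⟩
    · rcases eq_or_ne x 0 with rfl | hx0
      · exact hd.continuousAt.continuousWithinAt
      · exact (h1.continuousAt (ho.mem_nhds ⟨hx, hx0⟩)).continuousWithinAt
    · obtain rfl : j = 0 := by omega
      simpa using h3
  | succ p ih =>
    intro G h1 h2 h3
    have hd := aux G (fun x hx hx0 => by simpa using h2 0 (Nat.zero_le _) x hx hx0) h3
    have e : ((p + 1 : ℕ) : WithTop ℕ∞) = (p : WithTop ℕ∞) + 1 := by push_cast; rfl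
    rw [e, contDiffOn_succ_iff_deriv_of_isOpen ho] at h1
    obtain ⟨i1, i2⟩ := ih (deriv G) h1.2.2 (fun j hj x hx hx0 => by
      have := h2 (j + 1) (by omega) x hx hx0
      rwa [iteratedDeriv_succ'] at this) hd.deriv
    refine ⟨?_, fun j hj => ?_⟩
    · rw [e, contDiffOn_succ_iff_deriv_of_isOpen isOpen_Ioo]
      refine ⟨fun x hx => ?_, by simp, i1⟩
      rcases eq_or_ne x 0 with rfl | hx0
      · exact hd.differentiableAt.differentiableWithinAt
      · exact (h1.1.differentiableAt (ho.mem_nhds ⟨hx, hx0⟩)).differentiableWithinAt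
    · cases j with
      | zero => simpa using h3
      | succ j => rw [iteratedDeriv_succ']; exact i2 j (by omega)

/-- odd extension -/
def oddE (f : ℝ → ℝ) (x : ℝ) : ℝ := if 0 < x then f x else if x < 0 then - f (-x) else 0

theorem oddE_neg (f : ℝ → ℝ) (x : ℝ) : oddE f (-x) = - oddE f x := by
  unfold oddE
  rcases lt_trichotomy x 0 with h | h | h
  · simp [h, h.not_gt]
  · simp [h]
  · simp [h, h.not_gt]

theorem oddE_props {p : ℕ} {f : ℝ → ℝ} {δ C : ℝ} (hδ : 0 < δ)
    (h1 : ContDiffOn ℝ p f (Ioo 0 δ)) (h2 : StrictMonoOn f (Ioo 0 δ)) (h3 : ∀ x ∈ Ioo 0 δ, 0 < f x)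
    (h4 : ∀ j ≤ p, ∀ x ∈ Ioo 0 δ, |iteratedDeriv j f x| ≤ C * x ^ 2) :
    ContDiffOn ℝ p (oddE f) (Ioo (-δ) δ) ∧ (∀ j ≤ p, iteratedDeriv j (oddE f) 0 = 0) ∧
      StrictMonoOn (oddE f) (Ioo (-δ) δ) := by
  have evp : ∀ x, 0 < x → oddE f =ᶠ[𝓝 x] f := by
    intro x hx
    filter_upwards [Ioi_mem_nhds hx] with y hy
    have hy' : 0 < y := hy
    unfold oddE; rw [if_pos hy']
  have evn : ∀ x, x < 0 → oddE f =ᶠ[𝓝 x] fun y => - f (-y) := by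
    intro x hx
    filter_upwards [Iio_mem_nhds hx] with y hy
    have hy' : y < 0 := hy
    unfold oddE; rw [if_neg (not_lt.2 hy'.le), if_pos hy']
  have z : oddE f 0 = 0 := by simp [oddE]
  have cd : ∀ x ∈ Ioo 0 δ, ContDiffAt ℝ p f x := fun x hx => h1.contDiffAt (isOpen_Ioo.mem_nhds hx)
  obtain ⟨a1, a2⟩ := flat_ext p (C := C) hδ (oddE f) (by
    rintro x ⟨hx, hx0⟩
    rcases lt_or_gt_of_ne hx0 with h | h
    · refine ContDiffAt.contDiffWithinAt (ContDiffAt.congr_of_eventuallyEq ?_ (evn x h))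
      have := cd (-x) ⟨by linarith, by linarith [hx.1]⟩
      exact (this.comp x contDiff_neg.contDiffAt).neg
    · exact ((cd x ⟨h, hx.2⟩).congr_of_eventuallyEq (evp x h)).contDiffWithinAt) (by
    intro j hj x hx hx0
    rcases lt_or_gt_of_ne hx0 with h | h
    · rw [(evn x h).iteratedDeriv_eq, iteratedDeriv_fun_neg, iteratedDeriv_comp_neg]
      have := h4 j hj (-x) ⟨by linarith, by linarith [hx.1]⟩
      simpa [abs_mul] using this
    · rw [(evp x h).iteratedDeriv_eq]
      exact h4 j hj x ⟨h, hx.2⟩) z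
  refine ⟨a1, a2, fun x hx y hy hxy => ?_⟩
  have pos : ∀ x ∈ Ioo (-δ) δ, 0 < x → 0 < oddE f x := fun x hx h => by
    rw [(evp x h).eq_of_nhds]; exact h3 x ⟨h, hx.2⟩
  have neg : ∀ x ∈ Ioo (-δ) δ, x < 0 → oddE f x < 0 := fun x hx h => by
    rw [(evn x h).eq_of_nhds]
    have := h3 (-x) ⟨by linarith, by linarith [hx.1]⟩
    linarith
  rcases lt_trichotomy x 0 with h | h | h
  · rcases lt_trichotomy y 0 with h' | h' | h'
    · rw [(evn x h).eq_of_nhds, (evn y h').eq_of_nhds]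
      have := h2 (a := -y) (b := -x) ⟨by linarith, by linarith [hy.1]⟩ ⟨by linarith, by linarith [hx.1]⟩ (by linarith)
      linarith
    · subst h'; rw [z]; exact neg x hx h
    · exact (neg x hx h).trans (pos y hy h')
  · subst h; rw [z]; exact pos y hy hxy
  · rw [(evp x h).eq_of_nhds, (evp y (h.trans hxy)).eq_of_nhds]
    exact h2 ⟨h, hx.2⟩ ⟨h.trans hxy, hy.2⟩ hxy

/-- bounded odd increasing function -/
def kap (r x : ℝ) : ℝ := r * Real.sin (Real.arctan x)

theorem kap_contDiff (r : ℝ) {n : WithTop ℕ∞} : ContDiff ℝ n (kap r) :=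
  contDiff_const.mul (Real.contDiff_sin.comp Real.contDiff_arctan)
theorem kap_strict {r : ℝ} (hr : 0 < r) : StrictMono (kap r) := by
  intro x y h
  have := Real.strictMonoOn_sin ⟨(Real.neg_pi_div_two_lt_arctan x).le, (Real.arctan_lt_pi_div_two x).le⟩
    ⟨(Real.neg_pi_div_two_lt_arctan y).le, (Real.arctan_lt_pi_div_two y).le⟩ (Real.arctan_strictMono h)
  exact mul_lt_mul_of_pos_left this hr
theorem kap_mem {r : ℝ} (hr : 0 < r) (x : ℝ) : kap r x ∈ Ioo (-r) r := by
  have h1 := Real.cos_arctan_pos x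
  have h2 := Real.sin_sq_add_cos_sq (Real.arctan x)
  have h3 : |Real.sin (Real.arctan x)| < 1 := by
    rw [← sq_lt_one_iff_abs_lt_one]; nlinarith
  rw [abs_lt] at h3
  unfold kap
  constructor <;> nlinarith
theorem kap_zero (r : ℝ) : kap r 0 = 0 := by simp [kap]
theorem kap_neg (r x : ℝ) : kap r (-x) = - kap r x := by simp [kap]
theorem kap_le {r x : ℝ} (hr : 0 < r) (hr1 : r ≤ 1) (hx : 0 < x) : kap r x ≤ x := by
  have h1 : Real.sin (Real.arctan x) ≤ x := by
    rw [Real.sin_arctan]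
    refine div_le_self hx.le ?_
    rw [Real.one_le_sqrt]; nlinarith
  have h2 : 0 < Real.sin (Real.arctan x) := by rw [Real.sin_arctan]; positivity
  unfold kap
  nlinarith

section p8
variable {L}
theorem DR_sqrt (hO : ExpandsOrderedField L) : DR L Real.sqrt := by
  refine Df_graph (R := fun v y => (0 ≤ v () ∧ 0 ≤ y ∧ y ^ 2 = v ()) ∨ (v () < 0 ∧ y = 0)) ?_ ?_
  · simp (maxDischargeDepth := 99) [hO]
  · intro v y
    rcases lt_or_ge (v ()) 0 with h | h
    · rw [Real.sqrt_eq_zero_of_nonpos h.le]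
      simp [h, h.not_ge]
    · simp only [h, h.not_gt, true_and, false_and, or_false]
      constructor
      · rintro ⟨a, b⟩; rw [← b, Real.sqrt_sq a]
      · rintro rfl; exact ⟨Real.sqrt_nonneg _, Real.sq_sqrt h⟩

/-- unnormalized final function -/
def phi1 (p : ℕ) (f : ℝ → ℝ) (r x : ℝ) : ℝ :=
  oddE f (kap r x) + (max (x - 1 / 2) 0 ^ (p + 1) - max (-x - 1 / 2) 0 ^ (p + 1))

theorem DR_phi1 (hO : ExpandsOrderedField L) (p : ℕ) {f : ℝ → ℝ} (hf : DR L f) (r : ℝ) :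
    DR L (phi1 p f r) := by
  have h0 := DR_sqrt hO
  have h1 : DR L (oddE f) := by
    simp only [DR, oddE]
    simp (maxDischargeDepth := 99) [hO, hf.app]
  have h2 : DR L (kap r) := by
    simp only [DR, kap, Real.sin_arctan]
    simp (maxDischargeDepth := 99) [hO, h0.app]
  simp only [DR, phi1]
  simp (maxDischargeDepth := 99) [hO, h1.app, h2.app]

theorem finish (hO : ExpandsOrderedField L) (p : ℕ) {M : ℝ → ℝ} (hM0 : ∀ x, 0 ≤ M x)
    (hC : CoreConcl L p M) : ∃ φ : ℝ → ℝ, IsDefFunR L φ ∧ ContDiff ℝ p φ ∧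
      (∀ x : ℝ, φ (-x) = -φ x) ∧ StrictMono φ ∧ Function.Surjective φ ∧
      (∀ j : ℕ, j ≤ p → iteratedDeriv j φ 0 = 0) ∧ φ 1 = 1 ∧
      ∃ d B : ℝ, 0 < d ∧ ∀ x ∈ Ioo 0 d, φ x * M x ≤ B * x := by
  obtain ⟨f, δ, C, hδ, hf, h1, h2, h3, h4, h5⟩ := hC
  obtain ⟨o1, o2, o3⟩ := oddE_props hδ h1 h2 h3 h4
  set r := min δ 1 with hr
  have hr0 : 0 < r := by positivity
  have hr1 : r ≤ 1 := min_le_right _ _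
  have hrδ : r ≤ δ := min_le_left _ _
  have km : ∀ x, kap r x ∈ Ioo (-δ) δ := fun x =>
    ⟨by linarith [(kap_mem hr0 x).1], by linarith [(kap_mem hr0 x).2]⟩
  set ψ := phi1 p f r with hψ
  have hodd : ∀ x, ψ (-x) = - ψ x := by
    intro x
    simp only [hψ, phi1, kap_neg, oddE_neg, neg_neg]; ring
  have hst : StrictMono ψ := by
    intro x y h
    have a1 := o3 (km x) (km y) (kap_strict hr0 h)
    have a2 : max (x - 1 / 2) 0 ^ (p + 1) ≤ max (y - 1 / 2) 0 ^ (p + 1) := by gcongr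
    have a3 : max (-y - 1 / 2) 0 ^ (p + 1) ≤ max (-x - 1 / 2) 0 ^ (p + 1) := by gcongr
    simp only [hψ, phi1]
    linarith
  have c1 : ContDiff ℝ p (oddE f ∘ kap r) := by
    rw [contDiff_iff_contDiffAt]
    intro x
    exact (o1.contDiffAt (isOpen_Ioo.mem_nhds (km x))).comp x (kap_contDiff r).contDiffAt
  have hcd : ContDiff ℝ p ψ := by
    have c2 : ContDiff ℝ p (fun x : ℝ => max (x - 1 / 2) 0 ^ (p + 1)) :=
      (contDiff_posPow p).comp (contDiff_id.sub contDiff_const)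
    have c3 : ContDiff ℝ p (fun x : ℝ => max (-x - 1 / 2) 0 ^ (p + 1)) :=
      (contDiff_posPow p).comp (contDiff_neg.sub contDiff_const)
    exact c1.add (c2.sub c3)
  have hev : ψ =ᶠ[𝓝 0] oddE f ∘ kap r := by
    filter_upwards [Ioo_mem_nhds (show (-(1/2) : ℝ) < 0 by norm_num) (show (0:ℝ) < 1 / 2 by norm_num)] with x hx
    simp only [hψ, phi1, Function.comp]
    rw [max_eq_right (by linarith [hx.2]), max_eq_right (by linarith [hx.1])]
    simp
  have hflat : ∀ j ≤ p, iteratedDeriv j ψ 0 = 0 := by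
    intro j hj
    rw [hev.iteratedDeriv_eq, iteratedDeriv_comp_eq_sum_orderedFinpartition (n := p)
      (o1.contDiffAt (isOpen_Ioo.mem_nhds (km 0))) (kap_contDiff r).contDiffAt (by exact_mod_cast hj)]
    refine Finset.sum_eq_zero fun c _ => ?_
    rw [kap_zero, o2 _ (c.length_le.trans hj), zero_mul]
  have h0 : ψ 0 = 0 := by
    have := hodd 0
    rw [neg_zero] at this; linarith
  have hbig : ∀ X : ℝ, 2 ≤ X → X - 1 / 2 ≤ ψ X := by
    intro X hX
    have a1 := o3 (km 0) (km X) (kap_strict hr0 (by linarith))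
    have a2 : oddE f (kap r 0) = 0 := by simp [kap_zero, oddE]
    simp only [hψ, phi1]
    rw [max_eq_left (by linarith), max_eq_right (by linarith : -X - 1 / 2 ≤ 0)]
    have a3 : X - 1 / 2 ≤ (X - 1 / 2) ^ (p + 1) := le_self_pow₀ (by linarith) (by omega)
    simp only [ne_eq, Nat.add_eq_zero_iff, one_ne_zero, and_false, not_false_eq_true, zero_pow, sub_zero]
    linarith
  have hψ1 : 0 < ψ 1 := by rw [← h0]; exact hst one_pos
  have hsurj : Function.Surjective ψ := by
    intro y
    have b := hbig (|y| + 2) (by linarith [abs_nonneg y])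
    refine mem_range_of_exists_le_of_exists_ge hcd.continuous ⟨-(|y| + 2), ?_⟩ ⟨|y| + 2, ?_⟩
    · rw [hodd]; linarith [neg_abs_le y]
    · linarith [le_abs_self y]
  refine ⟨fun x => (ψ 1)⁻¹ * ψ x, ?_, contDiff_const.mul hcd, fun x => by simp only [hodd]; ring,
    fun x y h => mul_lt_mul_of_pos_left (hst h) (inv_pos.2 hψ1), ?_, ?_, inv_mul_cancel₀ hψ1.ne', ?_⟩
  · have hd := DR_phi1 hO p hf r
    refine DR.isDefFunR ?_
    simp only [DR]
    exact Df_mul hO (Df_const _) (DR.app hd (Df_var _))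
  · intro y
    obtain ⟨x, hx⟩ := hsurj (ψ 1 * y)
    exact ⟨x, by simp only [hx]; field_simp⟩
  · intro j hj
    rw [iteratedDeriv_const_mul_field, hflat j hj, mul_zero]
  · refine ⟨min δ (1 / 2), (ψ 1)⁻¹, by positivity, fun x hx => ?_⟩
    have hxδ : x < δ := hx.2.trans_le (min_le_left _ _)
    have hx2 : x < 1 / 2 := hx.2.trans_le (min_le_right _ _)
    have k0 : 0 < kap r x := by rw [← kap_zero r]; exact kap_strict hr0 hx.1
    have kx := kap_le hr0 hr1 hx.1
    have e1 : ψ x = f (kap r x) := by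
      simp only [hψ, phi1]
      rw [max_eq_right (by linarith), max_eq_right (by linarith [hx.1] : -x - 1 / 2 ≤ 0)]
      simp [oddE, k0]
    have e2 : f (kap r x) ≤ f x := h2.monotoneOn ⟨k0, by linarith⟩ ⟨hx.1, hxδ⟩ kx
    have e3 := h5 x ⟨hx.1, hxδ⟩
    have e4 : ψ x * M x ≤ x := by
      rw [e1]; exact (mul_le_mul_of_nonneg_right e2 (hM0 x)).trans e3
    rw [mul_assoc]
    exact mul_le_mul_of_nonneg_left e4 (inv_pos.2 hψ1).le
end p8

/-- the control function -/
def Mfun {n : ℕ} (A : Set (Fin n → ℝ)) (g : (Fin n → ℝ) → ℝ) (H : Finset ((Fin n → ℝ) → ℝ)) (s : ℝ) : ℝ :=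
  sInf {c | 0 ≤ c ∧ ∀ h : {h // h ∈ H}, ∀ x : Fin n → ℝ, ∀ u w : ℝ, (x ∈ A ∧ u = g x) →
    (x ∈ A \ {x | g x = 0} ∧ w = h.1 x) → (∀ i, |x i| ≤ 1 / s) →
    (∀ y : Fin n → ℝ, ((∀ e : ℝ, 0 < e → ∃ a : Fin n → ℝ, a ∈ A ∧ ∀ i, |y i - a i| < e) ∧ ¬ y ∈ A) →
      ¬ ∀ i, |x i - y i| < s) → s ≤ |u| → |w| ≤ c}

theorem closure_eps {n : ℕ} {A : Set (Fin n → ℝ)} {y : Fin n → ℝ} : y ∈ closure A ↔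
    ∀ e : ℝ, 0 < e → ∃ a : Fin n → ℝ, a ∈ A ∧ ∀ i, |y i - a i| < e := by
  rw [Metric.mem_closure_iff]
  refine forall_congr' fun e => imp_congr_right fun he => exists_congr fun a => and_congr_right fun _ => ?_
  rw [dist_pi_lt_iff he]
  rfl

section p9
variable {L}
theorem DR_Mfun (hO : ExpandsOrderedField L) {n : ℕ} {A : Set (Fin n → ℝ)} {g : (Fin n → ℝ) → ℝ}
    {H : Finset ((Fin n → ℝ) → ℝ)} (hA : IsDef L A) (hg : IsDefFunOn L A g)
    (hH : ∀ h ∈ H, IsDefFunOn L (A \ {x | g x = 0}) h) : DR L (Mfun A g H) := by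
  have hA' : ∀ {α : Type} (t : (α → ℝ) → Fin n → ℝ), (∀ i, Df L (fun v => t v i)) →
      Dp L (fun v => t v ∈ A) := fun t ht => Dp_subst (P := fun x => x ∈ A) hA ht
  have hF : ∀ {S : Set (Fin n → ℝ)} {k : (Fin n → ℝ) → ℝ}, IsDefFunOn L S k → ∀ {α : Type}
      (t : (α → ℝ) → Fin n → ℝ) (u : (α → ℝ) → ℝ), (∀ i, Df L (fun v => t v i)) → Df L u →
      Dp L (fun v => t v ∈ S ∧ u v = k (t v)) := by
    intro S k hk α t u ht hu
    exact Dp_subst (P := fun z : Fin n ⊕ Unit → ℝ => (fun i => z (Sum.inl i)) ∈ S ∧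
      z (Sum.inr ()) = k (fun i => z (Sum.inl i))) hk (t := fun v => Sum.elim (t v) (fun _ => u v))
      (by rintro (i | i); exacts [ht i, hu])
  unfold DR Mfun
  refine Df_sInf hO (P := fun v c => 0 ≤ c ∧ ∀ h : {h // h ∈ H}, ∀ x : Fin n → ℝ, ∀ u w : ℝ, (x ∈ A ∧ u = g x) →
    (x ∈ A \ {x | g x = 0} ∧ w = h.1 x) → (∀ i, |x i| ≤ 1 / v ()) →
    (∀ y : Fin n → ℝ, ((∀ e : ℝ, 0 < e → ∃ a : Fin n → ℝ, a ∈ A ∧ ∀ i, |y i - a i| < e) ∧ ¬ y ∈ A) →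
      ¬ ∀ i, |x i - y i| < v ()) → v () ≤ |u| → |w| ≤ c) ?_
  refine Dp_and (Dp_le hO (Df_const _) (Df_var _)) (Dp_finall fun h => Dp_allv (Dp_all (Dp_all ?_)))
  refine Dp_imp (hF hg _ _ (fun i => Df_var _) (Df_var _)) (Dp_imp (hF (hH h.1 h.2) _ _ (fun i => Df_var _) (Df_var _))
    (Dp_imp ?_ (Dp_imp ?_ ?_)))
  · simp (maxDischargeDepth := 99) [hO]
  · refine Dp_allv (Dp_imp (Dp_and (Dp_all (Dp_imp ?_ (Dp_exv (Dp_and (hA' _ (fun i => Df_var _)) ?_))))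
      (Dp_not (hA' _ (fun i => Df_var _)))) (Dp_not ?_))
    all_goals simp (maxDischargeDepth := 99) [hO]
  · simp (maxDischargeDepth := 99) [hO]
end p9

section p9b
variable {n : ℕ} {A : Set (Fin n → ℝ)} {g : (Fin n → ℝ) → ℝ} {H : Finset ((Fin n → ℝ) → ℝ)}

/-- exhausting compact sets -/
def KK (A : Set (Fin n → ℝ)) (s : ℝ) : Set (Fin n → ℝ) :=
  {x | x ∈ A ∧ (∀ i, |x i| ≤ 1 / s) ∧ ∀ y ∈ closure A \ A, ¬ ∀ i, |x i - y i| < s}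

theorem KK_compact (s : ℝ) (hs : 0 < s) : IsCompact (KK A s) := by
  have e : KK A s = closure A ∩ ((⋂ i, {x : Fin n → ℝ | |x i| ≤ 1 / s}) ∩
      ⋂ y ∈ closure A \ A, {x | s ≤ dist x y}) := by
    ext x
    have hd : ∀ y, (¬ ∀ i, |x i - y i| < s) ↔ s ≤ dist x y := by
      intro y
      rw [← not_lt, dist_pi_lt_iff hs]; rfl
    simp only [KK, mem_inter_iff, mem_iInter, mem_ofPred_eq, hd]
    constructor
    · rintro ⟨h1, h2, h3⟩
      exact ⟨subset_closure h1, h2, h3⟩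
    · rintro ⟨h1, h2, h3⟩
      refine ⟨?_, h2, h3⟩
      by_contra h
      have := h3 x ⟨h1, h⟩
      rw [dist_self] at this
      linarith
  have hc : IsClosed (KK A s) := by
    rw [e]
    refine isClosed_closure.inter (IsClosed.inter (isClosed_iInter fun i => ?_) (isClosed_biInter fun y _ => ?_))
    · exact isClosed_le (by fun_prop) continuous_const
    · exact isClosed_le continuous_const (by fun_prop)
  refine Metric.isCompact_of_isClosed_isBounded hc ?_
  refine (Metric.isBounded_closedBall (x := (0 : Fin n → ℝ)) (r := 1 / s)).subset fun x hx => ?_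
  rw [mem_closedBall_zero_iff, pi_norm_le_iff_of_nonneg (by positivity)]
  exact hx.2.1

theorem exists_bound (hgc : ContinuousOn g A)
    (hH : ∀ h ∈ H, ∀ x ∈ A \ {x | g x = 0}, ∃ U ∈ 𝓝 x, ∃ C : ℝ,
        ∀ y ∈ (A \ {x | g x = 0}) ∩ U, |h y| ≤ C) (s : ℝ) (hs : 0 < s) :
    ∃ c, 0 ≤ c ∧ ∀ h ∈ H, ∀ x ∈ KK A s, s ≤ |g x| → |h x| ≤ c := by
  have hKA : KK A s ⊆ A := fun x hx => hx.1
  have hB : IsCompact (KK A s ∩ g ⁻¹' {t | s ≤ |t|}) := by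
    refine (KK_compact s hs).of_isClosed_subset ?_ inter_subset_left
    exact (hgc.mono hKA).preimage_isClosed_of_isClosed (KK_compact s hs).isClosed
      (isClosed_le continuous_const continuous_abs)
  have hsub : KK A s ∩ g ⁻¹' {t | s ≤ |t|} ⊆ A \ {x | g x = 0} := by
    rintro x ⟨h1, h2⟩
    refine ⟨hKA h1, fun h0 => ?_⟩
    simp only [mem_preimage, mem_ofPred_eq] at h2 h0
    rw [h0, abs_zero] at h2
    linarith
  have one : ∀ h, ∃ c, h ∈ H → ∀ x ∈ KK A s ∩ g ⁻¹' {t | s ≤ |t|}, |h x| ≤ c := by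
    intro h
    by_cases hh : h ∈ H
    · obtain ⟨c, hc⟩ := hB.induction_on (p := fun T => ∃ c, ∀ x ∈ T ∩ (A \ {x | g x = 0}), |h x| ≤ c)
        ⟨0, by simp⟩ (fun S T hST ⟨c, hc⟩ => ⟨c, fun x hx => hc x ⟨hST hx.1, hx.2⟩⟩)
        (fun S T ⟨c, hc⟩ ⟨c', hc'⟩ => ⟨max c c', fun x hx => by
          rcases hx.1 with h1 | h1
          · exact (hc x ⟨h1, hx.2⟩).trans (le_max_left _ _)
          · exact (hc' x ⟨h1, hx.2⟩).trans (le_max_right _ _)⟩)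
        (fun x hx => by
          obtain ⟨U, hU, C, hC⟩ := hH h hh x (hsub hx)
          exact ⟨U, mem_nhdsWithin_of_mem_nhds hU, C, fun y hy => hC y ⟨hy.2, hy.1⟩⟩)
      exact ⟨c, fun _ x hx => hc x ⟨hx, hsub hx⟩⟩
    · exact ⟨0, fun h' => absurd h' hh⟩
  choose c hc using one
  refine ⟨∑ h ∈ H, |c h|, by positivity, fun h hh x hx hgx => ?_⟩
  exact (hc h hh x ⟨hx, hgx⟩).trans ((le_abs_self _).trans
    (Finset.single_le_sum (f := fun h => |c h|) (fun i _ => abs_nonneg _) hh))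

theorem Mfun_eq (s : ℝ) (hs : 0 < s) : Mfun A g H s =
    sInf {c | 0 ≤ c ∧ ∀ h ∈ H, ∀ x ∈ KK A s, s ≤ |g x| → |h x| ≤ c} := by
  unfold Mfun
  congr 1
  ext c
  simp only [mem_ofPred_eq]
  refine and_congr_right fun _ => ?_
  simp only [← closure_eps]
  constructor
  · intro h k hk x hx hgx
    refine h ⟨k, hk⟩ x _ _ ⟨hx.1, rfl⟩ ⟨⟨hx.1, fun h0 => ?_⟩, rfl⟩ hx.2.1 (fun y hy => hx.2.2 y hy) hgx
    simp only [mem_ofPred_eq] at h0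
    rw [h0, abs_zero] at hgx
    linarith
  · rintro h ⟨k, hk⟩ x u w ⟨h1, rfl⟩ ⟨h2, rfl⟩ h3 h4 h5
    exact h k hk x ⟨h1, h3, fun y hy => h4 y hy⟩ h5

theorem Mfun_nonneg (s : ℝ) : 0 ≤ Mfun A g H s := Real.sInf_nonneg (fun c hc => hc.1)

theorem KK_anti {s t : ℝ} (hs : 0 < s) (h : s ≤ t) : KK A t ⊆ KK A s := fun x hx =>
  ⟨hx.1, fun i => (hx.2.1 i).trans (one_div_le_one_div_of_le hs h),
    fun y hy h' => hx.2.2 y hy (fun i => (h' i).trans_le h)⟩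

theorem Mfun_anti (hgc : ContinuousOn g A)
    (hH : ∀ h ∈ H, ∀ x ∈ A \ {x | g x = 0}, ∃ U ∈ 𝓝 x, ∃ C : ℝ,
        ∀ y ∈ (A \ {x | g x = 0}) ∩ U, |h y| ≤ C) : AntitoneOn (Mfun A g H) (Ioi 0) := by
  intro s hs t ht hst
  rw [Mfun_eq s hs, Mfun_eq t ht]
  refine csInf_le_csInf ⟨0, fun c hc => hc.1⟩ (exists_bound hgc hH s hs) ?_
  rintro c ⟨h1, h2⟩
  exact ⟨h1, fun h hh x hx hgx => h2 h hh x (KK_anti hs hst hx) (hst.trans hgx)⟩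

theorem Mfun_bound (hgc : ContinuousOn g A)
    (hH : ∀ h ∈ H, ∀ x ∈ A \ {x | g x = 0}, ∃ U ∈ 𝓝 x, ∃ C : ℝ,
        ∀ y ∈ (A \ {x | g x = 0}) ∩ U, |h y| ≤ C) {s : ℝ} (hs : 0 < s) {h} (hh : h ∈ H) {x} (hx : x ∈ KK A s)
    (hgx : s ≤ |g x|) : |h x| ≤ Mfun A g H s := by
  rw [Mfun_eq s hs]
  exact le_csInf (exists_bound hgc hH s hs) (fun c hc => hc.2 h hh x hx hgx)

theorem KK_nhds (hA : IsLocallyClosed A) {y : Fin n → ℝ} (hy : y ∈ A) :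
    ∃ e, 0 < e ∧ ∀ x ∈ A, dist x y < e → ∀ s, 0 < s → s < e → x ∈ KK A s := by
  have ho : IsOpen (coborder A) := hA.isOpen_coborder
  have hyc : y ∈ coborder A := subset_coborder hy
  obtain ⟨r, hr, hb⟩ := Metric.isOpen_iff.1 ho y hyc
  refine ⟨min (r / 2) (1 / (‖y‖ + r)), by positivity, fun x hx hxy s hs hse => ⟨hx, fun i => ?_, fun z hz h => ?_⟩⟩
  · have h1 : dist x y < r / 2 := hxy.trans_le (min_le_left _ _)
    have h2 : s < 1 / (‖y‖ + r) := hse.trans_le (min_le_right _ _)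
    have h3 : ‖x‖ ≤ ‖y‖ + r := by
      rw [dist_eq_norm] at h1
      have := norm_le_norm_add_norm_sub y x
      rw [norm_sub_rev] at this
      linarith
    have h4 : |x i| ≤ ‖x‖ := norm_le_pi_norm x i
    refine h4.trans (h3.trans ?_)
    rw [le_div_iff₀ hs]
    rw [lt_div_iff₀ (by positivity)] at h2
    linarith
  · have h1 : dist x y < r / 2 := hxy.trans_le (min_le_left _ _)
    have h2 : s < r / 2 := hse.trans_le (min_le_left _ _)
    have h3 : dist x z < s := by rw [dist_pi_lt_iff hs]; exact h
    have h4 : z ∈ coborder A := hb (by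
      rw [Metric.mem_ball]
      have := dist_triangle_left z y x
      linarith)
    exact h4 hz
end p9b

/-- existence of a definable flat function taming a finite family of locally
bounded definable functions. -/
theorem stmt19 (L : FirstOrder.Language) [L.Structure ℝ] (hL : DMinimal L)
    (p n : ℕ) (hp : 1 ≤ p)
    (A : Set (Fin n → ℝ)) (hAdef : IsDef L A) (hAlc : IsLocallyClosed A)
    (g : (Fin n → ℝ) → ℝ) (hgdef : IsDefFunOn L A g) (hgc : ContinuousOn g A)
    (H : Finset ((Fin n → ℝ) → ℝ))
    (hH : ∀ h ∈ H, IsDefFunOn L (A \ {x | g x = 0}) h ∧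
      ∀ x ∈ A \ {x | g x = 0}, ∃ U ∈ 𝓝 x, ∃ C : ℝ,
        ∀ y ∈ (A \ {x | g x = 0}) ∩ U, |h y| ≤ C) :
    ∃ φ : ℝ → ℝ, IsDefFunR L φ ∧ ContDiff ℝ p φ ∧
      (∀ x : ℝ, φ (-x) = -φ x) ∧ StrictMono φ ∧ Function.Surjective φ ∧
      (∀ j : ℕ, j ≤ p → iteratedDeriv j φ 0 = 0) ∧ φ 1 = 1 ∧
      ∀ y ∈ A, g y = 0 → ∀ h ∈ H,
        Filter.Tendsto (fun x => φ (g x) * h x)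
          (nhdsWithin y (A \ {x | g x = 0})) (𝓝 0) := by
  have hO := hL.1
  have hHb : ∀ h ∈ H, ∀ x ∈ A \ {x | g x = 0}, ∃ U ∈ 𝓝 x, ∃ C : ℝ,
      ∀ y ∈ (A \ {x | g x = 0}) ∩ U, |h y| ≤ C := fun h hh => (hH h hh).2
  have hM := DR_Mfun hO hAdef hgdef (fun h hh => (hH h hh).1)
  have hMa := Mfun_anti hgc hHb
  have hC : CoreConcl L p (Mfun A g H) := by
    by_cases hT : Triv L
    · exact core_triv hT hO p hM Mfun_nonneg hMa
    · exact core_D hL hT p hM Mfun_nonneg hMa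
  obtain ⟨φ, f1, f2, f3, f4, f5, f6, f7, d, B, hd, hB⟩ := finish hO p Mfun_nonneg hC
  refine ⟨φ, f1, f2, f3, f4, f5, f6, f7, fun y hy hgy h hh => ?_⟩
  obtain ⟨e, he, hK⟩ := KK_nhds hAlc hy
  have hg0 : Tendsto (fun x => |g x|) (𝓝[A \ {x | g x = 0}] y) (𝓝 0) := by
    have h1 : Tendsto g (𝓝[A \ {x | g x = 0}] y) (𝓝 (g y)) := (hgc y hy).mono diff_subset
    rw [hgy] at h1
    simpa using h1.abs
  have hB0 : Tendsto (fun x => B * |g x|) (𝓝[A \ {x | g x = 0}] y) (𝓝 0) := by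
    simpa using hg0.const_mul B
  refine squeeze_zero_norm' ?_ hB0
  filter_upwards [hg0.eventually (gt_mem_nhds (lt_min hd he)), self_mem_nhdsWithin,
    mem_nhdsWithin_of_mem_nhds (Metric.ball_mem_nhds y he)] with x h1 h2 h3
  have hpos : 0 < |g x| := abs_pos.2 h2.2
  have hx := hK x h2.1 h3 |g x| hpos (h1.trans_le (min_le_right _ _))
  have b1 := Mfun_bound hgc hHb hpos hh hx le_rfl
  have b2 := hB |g x| ⟨hpos, h1.trans_le (min_le_left _ _)⟩
  have h0 : φ 0 = 0 := by
    have := f3 0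
    rw [neg_zero] at this; linarith
  have b3 : |φ (g x)| = φ |g x| := by
    rcases abs_cases (g x) with ⟨a1, a2⟩ | ⟨a1, a2⟩
    · rw [a1, abs_of_nonneg]
      rw [← h0]; exact f4.monotone a2
    · rw [a1, f3, abs_of_neg]
      rw [← h0]; exact f4 a2
  rw [Real.norm_eq_abs, abs_mul, b3]
  have b4 : 0 ≤ φ |g x| := by rw [← h0]; exact f4.monotone hpos.le
  exact (mul_le_mul_of_nonneg_left b1 b4).trans b2

end DMinPaper
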